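/- Let N > 2 be an integer and let f satisfy (H1). Let k ≥ 1 and suppose u* = u(α*, ·) is a k-th bound state solution (a nonconstant solution of the initial value problem with u*(0) = α*, u*'(0) = 0 that changes sign exactly k−1 times and satisfies lim_{r→∞} u*(r) = 0). Then there exists ε > 0 with the following property: for every ᾱ ∈ [α*−ε, α*+ε], if the solution u(ᾱ, ·) has k successive transversal zeros 0 < z₁ < ⋯ < z_k, i.e. u(ᾱ, z_i) = 0 and (−1)^{i−1}·u'(ᾱ, z_i) < 0 for i = 1,…,k, and u(ᾱ, ·) changes sign exactly at these points on (0, z_k], then |u(ᾱ, r)| < β for all r > z_k. -/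

import Mathlib

open Set Filter Topology

/-- `F(s) = ∫₀^s f(t) dt`. -/
noncomputable def Fint (f : ℝ → ℝ) (s : ℝ) : ℝ := ∫ t in (0:ℝ)..s, f t

/-- Hypothesis (H1) on the nonlinearity `f`, with parameters `b` and `β`. -/
def H1 (f : ℝ → ℝ) (b β : ℝ) : Prop :=
  ContinuousOn f (Ici 0) ∧
  (∃ T : Finset ℝ, ∀ s : ℝ, 0 < s → s ∉ T → ContDiffAt ℝ 1 f s) ∧
  f 0 = 0 ∧ 0 ≤ b ∧ (∀ s, b < s → 0 < f s) ∧ (∀ s ∈ Icc 0 b, f s ≤ 0) ∧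
  (∃ ε₀ > (0:ℝ), ∀ s ∈ Ioo 0 ε₀, f s < 0) ∧ (∀ s, f (-s) = -f s) ∧
  b ≤ β ∧ Fint f β = 0 ∧ ∀ β', b ≤ β' → Fint f β' = 0 → β' = β

/-- `u` is a (radial) solution of `u'' + ((N-1)/r)u' + f(u) = 0` on `(0,∞)`,
continuous up to `r = 0` with `u'(0) = 0`. -/
def IsRadialSol (N : ℕ) (f u : ℝ → ℝ) : Prop :=
  ContinuousOn u (Ici 0) ∧ HasDerivWithinAt u 0 (Ici 0) 0 ∧
  ∀ r : ℝ, 0 < r → DifferentiableAt ℝ u r ∧ DifferentiableAt ℝ (deriv u) r ∧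
    deriv (deriv u) r + (((N : ℝ) - 1) / r) * deriv u r + f (u r) = 0

/-- `u` changes sign exactly `m` times on `(0,∞)`. -/
def ChangesSignExactly (u : ℝ → ℝ) (m : ℕ) : Prop :=
  ∃ z : ℕ → ℝ, z 0 = 0 ∧ (∀ i < m, z i < z (i + 1)) ∧
    (∀ i, 1 ≤ i → i ≤ m → u (z i) = 0) ∧
    (∀ i < m, ∀ r, z i < r → r < z (i + 1) → 0 < (-1 : ℝ) ^ i * u r) ∧
    ∀ r, z m < r → 0 ≤ (-1 : ℝ) ^ m * u r

/-- Comparison at a first maximum of `|log (q₁ / q₂)|`, exponentially weighted. -/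
theorem log_ratio_deriv_lt {h n a₁ a₂ x₁ x₂ e K K' : ℝ} (hn : 0 ≤ n) (ha₁ : 0 < a₁) (ha₂ : 0 < a₂)
    (hx₁ : 0 < x₁) (hx₂ : 0 < x₂) (he : 0 < e) (hK' : 0 ≤ K') (hK : 2 * K' < K)
    (hq : Real.log a₁ - Real.log a₂ = e) (hx : x₁ ≤ Real.exp e * x₂)
    (hd : -K' * a₂ ≤ h / a₂ - n / x₂) :
    (h / a₁ - n / x₁) / a₁ - (h / a₂ - n / x₂) / a₂ < K * e := by
  obtain ⟨E, hE⟩ : ∃ E, E = Real.exp e := ⟨_, rfl⟩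
  have hE1 : 1 < E := by rw [hE]; exact Real.one_lt_exp_iff.mpr he
  have hE0 : 0 < E := by linarith
  have ha : a₁ = E * a₂ := by
    rw [hE, ← hq, Real.exp_sub, Real.exp_log ha₁, Real.exp_log ha₂]; field_simp
  have hx' : n / (E ^ 2 * x₂ * a₂) ≤ n / (x₁ * a₁) := by
    apply div_le_div_of_nonneg_left hn (by positivity)
    rw [ha]
    have := mul_le_mul_of_nonneg_right hx (by positivity : 0 ≤ E * a₂)
    rw [← hE] at this
    nlinarith
  have h1 : 1 - (E ^ 2)⁻¹ ≤ 2 * e := by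
    have h2 : (E ^ 2)⁻¹ = Real.exp (-(2 * e)) := by
      rw [hE, Real.exp_neg, ← Real.exp_nat_mul]; norm_num
    rw [h2]
    have := Real.add_one_le_exp (-(2 * e))
    linarith
  have h0 : 0 < 1 - (E ^ 2)⁻¹ := by
    have : (E ^ 2)⁻¹ < 1 := inv_lt_one_of_one_lt₀ (by nlinarith)
    linarith
  have hd' : -K' ≤ (h / a₂ - n / x₂) / a₂ := by
    rw [le_div_iff₀ ha₂]; exact hd
  calc (h / a₁ - n / x₁) / a₁ - (h / a₂ - n / x₂) / a₂
      = h / a₁ ^ 2 - n / (x₁ * a₁) - (h / a₂ - n / x₂) / a₂ := by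
        field_simp
    _ ≤ h / a₁ ^ 2 - n / (E ^ 2 * x₂ * a₂) - (h / a₂ - n / x₂) / a₂ := by linarith
    _ = -((1 - (E ^ 2)⁻¹) * ((h / a₂ - n / x₂) / a₂)) := by
        rw [ha]; field_simp; ring
    _ ≤ (1 - (E ^ 2)⁻¹) * K' := by nlinarith
    _ ≤ 2 * e * K' := by gcongr
    _ < K * e := by nlinarith

theorem level_time_le {q₁ q₂ x₁ x₂ : ℝ → ℝ} {s E r₀ : ℝ} (hs : 0 < s) (hE : 1 ≤ E) (hr₀ : 0 ≤ r₀)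
    (hx₁c : ContinuousOn x₁ (Icc 0 s)) (hx₂c : ContinuousOn x₂ (Icc 0 s))
    (h₁0 : x₁ 0 = r₀) (h₂0 : x₂ 0 = r₀)
    (hq₁ : ∀ t ∈ Ioo 0 s, 0 < q₁ t) (hq₂ : ∀ t ∈ Ioo 0 s, 0 < q₂ t)
    (hx₁ : ∀ t ∈ Ioo 0 s, HasDerivAt x₁ (1 / q₁ t) t)
    (hx₂ : ∀ t ∈ Ioo 0 s, HasDerivAt x₂ (1 / q₂ t) t)
    (hq : ∀ t ∈ Ioo 0 s, q₂ t ≤ E * q₁ t) : x₁ s ≤ E * x₂ s := by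
  have hm : MonotoneOn (fun t => E * x₂ t - x₁ t) (Icc 0 s) := by
    apply monotoneOn_of_deriv_nonneg (convex_Icc 0 s)
    · exact (continuousOn_const.mul hx₂c).sub hx₁c
    · rw [interior_Icc]
      intro t ht
      exact (((hx₂ t ht).const_mul E).sub (hx₁ t ht)).differentiableAt.differentiableWithinAt
    · rw [interior_Icc]
      intro t ht
      have := (((hx₂ t ht).const_mul E).sub (hx₁ t ht)).deriv
      have h3 : deriv (fun t => E * x₂ t - x₁ t) t = E * (1 / q₂ t) - 1 / q₁ t := this
      rw [h3, sub_nonneg, mul_one_div, div_le_div_iff₀ (hq₁ t ht) (hq₂ t ht)]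
      linarith [hq t ht]
  have := hm (left_mem_Icc.mpr hs.le) (right_mem_Icc.mpr hs.le) hs.le
  simp only [h₁0, h₂0] at this
  nlinarith

/-- Uniqueness in the level variable: `xᵢ` is the time at which the level `s` is reached and `qᵢ` the
speed there. -/
theorem level_speed_unique {h q₁ q₂ x₁ x₂ : ℝ → ℝ} {S r₀ n K' : ℝ} (hn : 0 ≤ n)
    (hr₀ : 0 ≤ r₀) (hK' : 0 ≤ K')
    (hx₁c : ContinuousOn x₁ (Icc 0 S)) (hx₂c : ContinuousOn x₂ (Icc 0 S))
    (h₁0 : x₁ 0 = r₀) (h₂0 : x₂ 0 = r₀)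
    (hx₁p : ∀ t ∈ Ioc 0 S, 0 < x₁ t) (hx₂p : ∀ t ∈ Ioc 0 S, 0 < x₂ t)
    (hq₁ : ∀ t ∈ Ioc 0 S, 0 < q₁ t) (hq₂ : ∀ t ∈ Ioc 0 S, 0 < q₂ t)
    (hx₁ : ∀ t ∈ Ioc 0 S, HasDerivAt x₁ (1 / q₁ t) t)
    (hx₂ : ∀ t ∈ Ioc 0 S, HasDerivAt x₂ (1 / q₂ t) t)
    (hd₁ : ∀ t ∈ Ioc 0 S, HasDerivAt q₁ (h t / q₁ t - n / x₁ t) t)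
    (hd₂ : ∀ t ∈ Ioc 0 S, HasDerivAt q₂ (h t / q₂ t - n / x₂ t) t)
    (hl₁ : ∀ t ∈ Ioc 0 S, -K' * q₁ t ≤ h t / q₁ t - n / x₁ t)
    (hl₂ : ∀ t ∈ Ioc 0 S, -K' * q₂ t ≤ h t / q₂ t - n / x₂ t)
    (hlim : Tendsto (fun t => Real.log (q₁ t) - Real.log (q₂ t)) (𝓝[>] 0) (𝓝 0)) :
    ∀ t ∈ Ioc 0 S, q₁ t = q₂ t := by
  intro t ht
  by_contra hne
  have hS : 0 < S := ht.1.trans_le ht.2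
  obtain ⟨K, hK⟩ : ∃ K, K = 2 * K' + 1 := ⟨_, rfl⟩
  set φ : ℝ → ℝ := fun t => Real.log (q₁ t) - Real.log (q₂ t) with hφ
  have hφd : ∀ t ∈ Ioc 0 S, HasDerivAt φ
      ((h t / q₁ t - n / x₁ t) / q₁ t - (h t / q₂ t - n / x₂ t) / q₂ t) t := fun t ht =>
    ((hd₁ t ht).log (hq₁ t ht).ne').sub ((hd₂ t ht).log (hq₂ t ht).ne')
  set ψ : ℝ → ℝ := fun t => if t ≤ 0 then 0 else |φ t| * Real.exp (-K * t) with hψ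
  have hψp : ∀ t, 0 < t → ψ t = |φ t| * Real.exp (-K * t) := fun t ht => by
    simp [hψ, not_le.mpr ht]
  have hψc : ContinuousOn ψ (Icc 0 S) := by
    intro x hx
    rcases hx.1.eq_or_lt with h0 | h0
    · subst h0
      have h1 : Tendsto ψ (𝓝[>] 0) (𝓝 (ψ 0)) := by
        have h2 : Tendsto (fun t => |φ t| * Real.exp (-K * t)) (𝓝[>] 0)
            (𝓝 (|0| * Real.exp (-K * 0))) := by
          apply hlim.abs.mul
          apply tendsto_nhdsWithin_of_tendsto_nhds
          exact (by fun_prop : Continuous fun t => Real.exp (-K * t)).tendsto 0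
        have h3 : ψ 0 = |0| * Real.exp (-K * 0) := by simp [hψ]
        rw [h3]
        refine h2.congr' ?_
        filter_upwards [self_mem_nhdsWithin] with t ht
        exact (hψp t ht).symm
      have h4 : ContinuousWithinAt ψ (Ici 0) 0 := by
        rw [← Ioi_insert, continuousWithinAt_insert_self]; exact h1
      exact h4.mono Icc_subset_Ici_self
    · apply ContinuousAt.continuousWithinAt
      have h1 : ContinuousAt (fun t => |φ t| * Real.exp (-K * t)) x :=
        (hφd x ⟨h0, hx.2⟩).continuousAt.abs.mul (by fun_prop)
      refine h1.congr ?_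
      filter_upwards [Ioi_mem_nhds h0] with t ht
      exact (hψp t ht).symm
  obtain ⟨m, hm, hmax⟩ := isCompact_Icc.exists_isMaxOn (nonempty_Icc.mpr hS.le) hψc
  have hφt : φ t ≠ 0 := by
    intro h0
    exact hne (Real.log_injOn_pos (hq₁ t ht) (hq₂ t ht) (sub_eq_zero.mp h0))
  have hψt : 0 < ψ t := by
    rw [hψp t ht.1]; have := abs_pos.mpr hφt; positivity
  have hψm : 0 < ψ m := hψt.trans_le (hmax ⟨ht.1.le, ht.2⟩)
  have hm0 : 0 < m := by
    rcases hm.1.eq_or_lt with h0 | h0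
    · rw [← h0] at hψm; simp [hψ] at hψm
    · exact h0
  have hmS : m ∈ Ioc 0 S := ⟨hm0, hm.2⟩
  obtain ⟨e, he⟩ : ∃ e, e = |φ m| := ⟨_, rfl⟩
  have he0 : 0 < e := by
    rw [hψp m hm0, ← he] at hψm
    exact pos_of_mul_pos_left hψm (Real.exp_pos _).le
  -- bound before `m`
  have hbd : ∀ t ∈ Ioo 0 m, |φ t| ≤ e * Real.exp (K * (t - m)) := by
    intro t ht
    have h1 := hmax (show t ∈ Icc 0 S from ⟨ht.1.le, ht.2.le.trans hm.2⟩)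
    simp only [mem_ofPred_eq] at h1
    rw [hψp t ht.1, hψp m hm0, ← he] at h1
    have h2 : e * Real.exp (K * (t - m)) = e * Real.exp (-K * m) * Real.exp (K * t) := by
      rw [mul_assoc, ← Real.exp_add]; ring_nf
    rw [h2]
    calc |φ t| = |φ t| * Real.exp (-K * t) * Real.exp (K * t) := by
          rw [mul_assoc, ← Real.exp_add]; simp
      _ ≤ _ := by gcongr
  have hbe : ∀ t ∈ Ioo 0 m, |φ t| ≤ e := by
    intro t ht
    refine (hbd t ht).trans ?_
    have : Real.exp (K * (t - m)) ≤ 1 := by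
      rw [Real.exp_le_one_iff]
      nlinarith [ht.2]
    nlinarith
  -- the slope of `c * φ` at `m`
  have hslope : ∀ c d : ℝ, |c| = 1 → c * φ m = e → HasDerivAt (fun t => c * φ t) d m →
      K * e ≤ d := by
    intro c d hc hce hd
    by_contra hlt
    push Not at hlt
    have h1 : HasDerivAt (fun t => c * φ t - e * Real.exp (K * (t - m))) (d - K * e) m := by
      have h2 : HasDerivAt (fun t => e * Real.exp (K * (t - m))) (K * e) m := by
        have := ((((hasDerivAt_id m).sub_const m).const_mul K).exp).const_mul e
        refine this.congr_deriv ?_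
        simp; ring
      exact hd.sub h2
    have h3 : ∀ᶠ t in 𝓝[<] m, 0 < c * φ t - e * Real.exp (K * (t - m)) := by
      have h4 := (hasDerivAt_iff_tendsto_slope.mp h1).mono_left
        (nhdsWithin_mono m (fun x (hx : x < m) => hx.ne : Iio m ⊆ {m}ᶜ))
      have h5 := h4.eventually_lt_const (show d - K * e < 0 by linarith)
      filter_upwards [h5, self_mem_nhdsWithin] with t ht htm
      rw [slope_def_field] at ht
      simp only [hce, sub_self, mul_zero, Real.exp_zero, mul_one, sub_zero] at ht
      have htm' : t - m < 0 := sub_neg.mpr htm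
      by_contra hcon
      push Not at hcon
      have := div_nonneg_of_nonpos hcon htm'.le
      linarith
    have h6 : ∀ᶠ t in 𝓝[<] m, t ∈ Ioo 0 m := Ioo_mem_nhdsLT hm0
    obtain ⟨t, ht1, ht2⟩ := (h3.and h6).exists
    have h7 := hbd t ht2
    have h8 : c * φ t ≤ |φ t| := by
      calc c * φ t ≤ |c * φ t| := le_abs_self _
        _ = |φ t| := by rw [abs_mul, hc, one_mul]
    linarith
  have hsub : Icc 0 m ⊆ Icc 0 S := Icc_subset_Icc_right hm.2
  have hq12 : ∀ t ∈ Ioo 0 m, q₂ t ≤ Real.exp e * q₁ t ∧ q₁ t ≤ Real.exp e * q₂ t := by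
    intro t ht
    have htS : t ∈ Ioc 0 S := ⟨ht.1, ht.2.le.trans hm.2⟩
    have h1 := abs_le.mp (hbe t ht)
    have p1 := hq₁ t htS
    have p2 := hq₂ t htS
    simp only [hφ] at h1
    constructor
    · rw [← Real.log_le_log_iff p2 (by positivity), Real.log_mul (by positivity) p1.ne',
        Real.log_exp]
      linarith
    · rw [← Real.log_le_log_iff p1 (by positivity), Real.log_mul (by positivity) p2.ne',
        Real.log_exp]
      linarith
  have hlift : ∀ t ∈ Ioo 0 m, t ∈ Ioc 0 S := fun t ht => ⟨ht.1, ht.2.le.trans hm.2⟩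
  have hE1 : 1 ≤ Real.exp e := Real.one_le_exp he0.le
  rcases abs_cases (φ m) with ⟨h1, -⟩ | ⟨h1, -⟩
  · have hx : x₁ m ≤ Real.exp e * x₂ m :=
      level_time_le hm0 hE1 hr₀ (hx₁c.mono hsub) (hx₂c.mono hsub) h₁0 h₂0
        (fun t ht => hq₁ t (hlift t ht)) (fun t ht => hq₂ t (hlift t ht))
        (fun t ht => hx₁ t (hlift t ht)) (fun t ht => hx₂ t (hlift t ht))
        (fun t ht => (hq12 t ht).1)
    have h2 := log_ratio_deriv_lt hn (hq₁ m hmS) (hq₂ m hmS) (hx₁p m hmS) (hx₂p m hmS) he0 hK'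
      (by linarith : 2 * K' < K) (by rw [he, h1]) hx (hl₂ m hmS)
    have h3 := hslope 1 _ (by simp) (by rw [he, h1, one_mul]) ((hφd m hmS).const_mul 1)
    linarith
  · have hx : x₂ m ≤ Real.exp e * x₁ m :=
      level_time_le hm0 hE1 hr₀ (hx₂c.mono hsub) (hx₁c.mono hsub) h₂0 h₁0
        (fun t ht => hq₂ t (hlift t ht)) (fun t ht => hq₁ t (hlift t ht))
        (fun t ht => hx₂ t (hlift t ht)) (fun t ht => hx₁ t (hlift t ht))
        (fun t ht => (hq12 t ht).2)
    have h2 := log_ratio_deriv_lt hn (hq₂ m hmS) (hq₁ m hmS) (hx₂p m hmS) (hx₁p m hmS) he0 hK'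
      (by linarith : 2 * K' < K) (by rw [he, h1]; simp [hφ]) hx (hl₁ m hmS)
    have h3 := hslope (-1) _ (by simp) (by rw [he, h1]; ring) ((hφd m hmS).const_mul (-1))
    linarith

/-- `u` solves `u'' + (n / r) u' + f(u) = 0` on `s`, with derivative `p`. -/
def SolvesOn (n : ℝ) (f u p : ℝ → ℝ) (s : Set ℝ) : Prop :=
  ∀ r ∈ s, HasDerivAt u (p r) r ∧ HasDerivAt p (-(n / r) * p r - f (u r)) r

theorem SolvesOn.mono {n : ℝ} {f u p : ℝ → ℝ} {s t : Set ℝ} (h : SolvesOn n f u p s) (hts : t ⊆ s) :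
    SolvesOn n f u p t := fun r hr => h r (hts hr)

theorem SolvesOn.neg {n : ℝ} {f u p : ℝ → ℝ} {s : Set ℝ} (hf : ∀ x, f (-x) = -f x)
    (h : SolvesOn n f u p s) : SolvesOn n f (fun r => -u r) (fun r => -p r) s := by
  intro r hr
  refine ⟨(h r hr).1.neg, (h r hr).2.neg.congr_deriv ?_⟩
  rw [hf]; ring

theorem exists_continuous_inverse {w : ℝ → ℝ} {a c : ℝ} (hac : a ≤ c)
    (hw : ContinuousOn w (Icc a c)) (hm : StrictMonoOn w (Icc a c)) :
    ∃ R : ℝ → ℝ, Continuous R ∧ StrictMono R ∧ (∀ r ∈ Icc a c, R (w r) = r) ∧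
      ∀ s ∈ Icc (w a) (w c), w (R s) = s := by
  set cl : ℝ → ℝ := fun r => max a (min r c) with hcl
  have hclm : ∀ r, cl r ∈ Icc a c := fun r => ⟨le_max_left _ _, max_le hac (min_le_right _ _)⟩
  have hcl_id : ∀ r ∈ Icc a c, cl r = r := fun r hr => by simp [hcl, hr.1, hr.2]
  set W : ℝ → ℝ := fun r => w (cl r) + (r - cl r) with hW
  have hWc : Continuous W := by
    have h1 : Continuous cl := by fun_prop
    exact (hw.comp_continuous h1 hclm).add (continuous_id.sub h1)
  have hWm : StrictMono W := by
    intro x y hxy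
    have h1 : cl x ≤ cl y := max_le_max le_rfl (min_le_min hxy.le le_rfl)
    have h2 : cl y - cl x ≤ y - x := by
      simp only [hcl]
      rcases max_cases a (min x c) with h | h <;> rcases max_cases a (min y c) with h' | h' <;>
        rcases min_cases x c with g | g <;> rcases min_cases y c with g' | g' <;> linarith
    rcases h1.eq_or_lt with h | h
    · simp only [hW, h]; linarith
    · have := hm (hclm x) (hclm y) h
      simp only [hW]; linarith
  have hWs : Function.Surjective W := by
    apply hWc.surjective
    · refine tendsto_atTop_mono' _ ?_ (tendsto_atTop_add_const_right atTop (w c - c) tendsto_id)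
      filter_upwards [Ici_mem_atTop c] with r hr
      have : cl r = c := by simp [hcl, hac, mem_Ici.mp hr]
      simp only [hW, this, id]; linarith
    · refine tendsto_atBot_mono' _ ?_ (tendsto_atBot_add_const_right atBot (w a - a) tendsto_id)
      filter_upwards [Iic_mem_atBot a] with r hr
      have : cl r = a := by
        simp only [hcl]; rw [min_eq_left (le_trans hr hac), max_eq_left hr]
      simp only [hW, this, id]; linarith
  let e := hWm.orderIsoOfSurjective W hWs
  have he : ∀ x, e x = W x := fun x => rfl
  have hWw : ∀ r ∈ Icc a c, W r = w r := fun r hr => by simp [hW, hcl_id r hr]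
  refine ⟨e.symm, e.symm.continuous, e.symm.strictMono, fun r hr => ?_, fun s hs => ?_⟩
  · rw [← hWw r hr, ← he, e.symm_apply_apply]
  · have h1 : e.symm s ∈ Icc a c := by
      constructor
      · rw [← e.symm_apply_apply a, he, hWw a ⟨le_rfl, hac⟩]
        exact e.symm.monotone hs.1
      · rw [← e.symm_apply_apply c, he, hWw c ⟨hac, le_rfl⟩]
        exact e.symm.monotone hs.2
    rw [← hWw _ h1, ← he, e.apply_symm_apply]

/-- A strictly decreasing solution, described through the time and speed at depth `s` below its
initial value. -/
theorem SolvesOn.exists_level {n : ℝ} {f u p : ℝ → ℝ} {r₀ δ : ℝ} (hδ : 0 < δ)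
    (hu : SolvesOn n f u p (Ioo r₀ (r₀ + δ))) (huc : ContinuousWithinAt u (Ici r₀) r₀)
    (hp : ∀ r ∈ Ioo r₀ (r₀ + δ), p r < 0) :
    ∃ S > 0, ∃ x : ℝ → ℝ, Continuous x ∧ StrictMono x ∧ x 0 = r₀ ∧
      ∀ s ∈ Ioc 0 S, x s ∈ Ioo r₀ (r₀ + δ) ∧ u (x s) = u r₀ - s ∧
        HasDerivAt x (1 / (-p (x s))) s ∧
        HasDerivAt (fun s => -p (x s)) (f (u r₀ - s) / (-p (x s)) - n / x s) s := by
  set w : ℝ → ℝ := fun r => u r₀ - u r with hw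
  have hsub : ∀ r ∈ Ioc r₀ (r₀ + δ / 2), r ∈ Ioo r₀ (r₀ + δ) := fun r hr =>
    ⟨hr.1, by linarith [hr.2]⟩
  have hwd : ∀ r ∈ Ioo r₀ (r₀ + δ), HasDerivAt w (-p r) r := fun r hr =>
    ((hu r hr).1.const_sub _)
  have hle : r₀ ≤ r₀ + δ / 2 := by linarith
  have hwc : ContinuousOn w (Icc r₀ (r₀ + δ / 2)) := by
    intro r hr
    rcases hr.1.eq_or_lt with h | h
    · subst h
      exact (continuousWithinAt_const.sub huc).mono Icc_subset_Ici_self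
    · exact (hwd r (hsub r ⟨h, hr.2⟩)).continuousAt.continuousWithinAt
  have hwm : StrictMonoOn w (Icc r₀ (r₀ + δ / 2)) := by
    apply strictMonoOn_of_deriv_pos (convex_Icc _ _) hwc
    rw [interior_Icc]
    intro r hr
    have hr' := hsub r ⟨hr.1, hr.2.le⟩
    rw [(hwd r hr').deriv]
    linarith [hp r hr']
  obtain ⟨x, hxc, hxm, hxl, hxr⟩ := exists_continuous_inverse hle hwc hwm
  have hw0 : w r₀ = 0 := by simp [hw]
  have hx0 : x 0 = r₀ := by rw [← hw0]; exact hxl r₀ ⟨le_rfl, hle⟩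
  have hSpos : 0 < w (r₀ + δ / 2) := by
    rw [← hw0]; exact hwm ⟨le_rfl, hle⟩ ⟨hle, le_rfl⟩ (by linarith)
  rw [hw0] at hxr
  refine ⟨w (r₀ + δ / 2) / 2, by positivity, x, hxc, hxm, hx0, fun s hs => ?_⟩
  have hsS : s < w (r₀ + δ / 2) := by linarith [hs.2]
  have hxs : x s ∈ Ioo r₀ (r₀ + δ / 2) := by
    constructor
    · rw [← hx0]; exact hxm hs.1
    · rw [← hxl (r₀ + δ / 2) ⟨hle, le_rfl⟩]; exact hxm hsS
  have hxs' := hsub _ ⟨hxs.1, hxs.2.le⟩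
  have hws : w (x s) = s := hxr s ⟨hs.1.le, hsS.le⟩
  have hus : u (x s) = u r₀ - s := by simp only [hw] at hws; linarith
  have hps := hp _ hxs'
  have hxd : HasDerivAt x (1 / (-p (x s))) s := by
    rw [one_div]
    refine HasDerivAt.of_local_left_inverse hxc.continuousAt (hwd _ hxs') (by linarith) ?_
    filter_upwards [Ioo_mem_nhds hs.1 hsS] with t ht
    exact hxr t ⟨ht.1.le, ht.2.le⟩
  refine ⟨hxs', hus, hxd, ?_⟩
  have := ((hu _ hxs').2.comp s hxd).neg
  refine this.congr_deriv ?_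
  rw [hus]
  have h1 : p (x s) ≠ 0 := hps.ne
  field_simp
  ring

theorem SolvesOn.eq_right_of_neg {n K : ℝ} {f u p v q : ℝ → ℝ} {r₀ δ ℓ : ℝ} {j : ℕ} (hn : 0 ≤ n)
    (hr₀ : 0 ≤ r₀) (hK : 0 ≤ K) (hδ : 0 < δ)
    (hu : SolvesOn n f u p (Ioo r₀ (r₀ + δ))) (hv : SolvesOn n f v q (Ioo r₀ (r₀ + δ)))
    (huc : ContinuousWithinAt u (Ici r₀) r₀) (hvc : ContinuousWithinAt v (Ici r₀) r₀)
    (h0 : u r₀ = v r₀)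
    (hp : ∀ r ∈ Ioo r₀ (r₀ + δ), p r < 0) (hq : ∀ r ∈ Ioo r₀ (r₀ + δ), q r < 0)
    (hKp : ∀ r ∈ Ioo r₀ (r₀ + δ), -(n / r) * p r - f (u r) ≤ K * p r ^ 2)
    (hKq : ∀ r ∈ Ioo r₀ (r₀ + δ), -(n / r) * q r - f (v r) ≤ K * q r ^ 2)
    (hℓ : 0 < ℓ)
    (hlp : Tendsto (fun r => p r ^ 2 / (u r₀ - u r) ^ j) (𝓝[>] r₀) (𝓝 ℓ))
    (hlq : Tendsto (fun r => q r ^ 2 / (v r₀ - v r) ^ j) (𝓝[>] r₀) (𝓝 ℓ)) :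
    ∃ δ' > 0, ∀ r ∈ Icc r₀ (r₀ + δ'), u r = v r := by
  obtain ⟨S₁, hS₁, x, hxc, hxm, hx0, hx⟩ := hu.exists_level hδ huc hp
  obtain ⟨S₂, hS₂, y, hyc, hym, hy0, hy⟩ := hv.exists_level hδ hvc hq
  set S := min S₁ S₂ with hS
  have hSp : 0 < S := lt_min hS₁ hS₂
  have hi₁ : ∀ s ∈ Ioc 0 S, s ∈ Ioc 0 S₁ := fun s hs => ⟨hs.1, hs.2.trans (min_le_left _ _)⟩
  have hi₂ : ∀ s ∈ Ioc 0 S, s ∈ Ioc 0 S₂ := fun s hs => ⟨hs.1, hs.2.trans (min_le_right _ _)⟩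
  have hlow : ∀ (z g w : ℝ → ℝ) (s : ℝ), 0 < s → w (z s) = w r₀ - s →
      g (z s) < 0 → -(n / z s) * g (z s) - f (w (z s)) ≤ K * g (z s) ^ 2 →
      -K * -g (z s) ≤ f (w r₀ - s) / -g (z s) - n / z s := by
    intro z g w s _ h2 h3 h4
    rw [h2] at h4
    have h5 : f (w r₀ - s) / -g (z s) - n / z s
        = (n / z s * g (z s) + f (w r₀ - s)) / -g (z s) := by
      have : g (z s) ≠ 0 := h3.ne
      field_simp
      ring
    rw [h5, le_div_iff₀ (by linarith)]
    nlinarith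
  have hlogt : ∀ (z g w : ℝ → ℝ) (T : ℝ), 0 < T → Continuous z → StrictMono z → z 0 = r₀ →
      (∀ s ∈ Ioc 0 T, g (z s) < 0 ∧ w (z s) = w r₀ - s) →
      Tendsto (fun r => g r ^ 2 / (w r₀ - w r) ^ j) (𝓝[>] r₀) (𝓝 ℓ) →
      Tendsto (fun s => 2 * Real.log (-g (z s)) - j * Real.log s) (𝓝[>] 0) (𝓝 (Real.log ℓ)) := by
    intro z g w T hT hzc hzm hz0 hz hl
    have h1 : Tendsto z (𝓝[>] 0) (𝓝[>] r₀) := by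
      apply tendsto_nhdsWithin_of_tendsto_nhds_of_eventually_within
      · rw [← hz0]; exact (hzc.tendsto 0).mono_left nhdsWithin_le_nhds
      · filter_upwards [self_mem_nhdsWithin] with s hs
        have := hzm (show (0 : ℝ) < s from hs)
        rwa [hz0] at this
    have h2 := (hl.comp h1).log hℓ.ne'
    refine h2.congr' ?_
    filter_upwards [Ioc_mem_nhdsGT hT] with s hs
    obtain ⟨h3, h4⟩ := hz s hs
    have h5 : w r₀ - (w r₀ - s) = s := by ring
    simp only [Function.comp_apply]
    rw [h4, h5, Real.log_div (pow_ne_zero 2 h3.ne) (by have := hs.1; positivity), Real.log_pow,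
      Real.log_pow, Real.log_neg_eq_log]
    norm_num
  have hlim : Tendsto (fun s => Real.log (-p (x s)) - Real.log (-q (y s))) (𝓝[>] 0) (𝓝 0) := by
    have h1 := hlogt x p u S₁ hS₁ hxc hxm hx0 (fun s hs => ⟨hp _ (hx s hs).1, (hx s hs).2.1⟩) hlp
    have h2 := hlogt y q v S₂ hS₂ hyc hym hy0 (fun s hs => ⟨hq _ (hy s hs).1, (hy s hs).2.1⟩) hlq
    have h3 := (h1.sub h2).const_mul (1 / 2)
    rw [sub_self, mul_zero] at h3
    refine h3.congr fun s => ?_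
    ring
  have hqq := level_speed_unique (h := fun s => f (u r₀ - s)) (S := S) (n := n) (K' := K)
    (q₁ := fun s => -p (x s)) (q₂ := fun s => -q (y s)) hn hr₀ hK
    hxc.continuousOn hyc.continuousOn hx0 hy0
    (fun s hs => hr₀.trans_lt (hx s (hi₁ s hs)).1.1)
    (fun s hs => hr₀.trans_lt (hy s (hi₂ s hs)).1.1)
    (fun s hs => neg_pos.mpr (hp _ (hx s (hi₁ s hs)).1))
    (fun s hs => neg_pos.mpr (hq _ (hy s (hi₂ s hs)).1))
    (fun s hs => (hx s (hi₁ s hs)).2.2.1) (fun s hs => (hy s (hi₂ s hs)).2.2.1)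
    (fun s hs => (hx s (hi₁ s hs)).2.2.2)
    (fun s hs => by rw [h0]; exact (hy s (hi₂ s hs)).2.2.2)
    (fun s hs => by
      have hs' := hx s (hi₁ s hs)
      exact hlow x p u s hs.1 hs'.2.1 (hp _ hs'.1) (hKp _ hs'.1))
    (fun s hs => by
      have hs' := hy s (hi₂ s hs)
      rw [h0]
      exact hlow y q v s hs.1 hs'.2.1 (hq _ hs'.1) (hKq _ hs'.1)) hlim
  have hxy : ∀ s ∈ Icc 0 S, x s = y s := by
    intro s hs
    rcases hs.1.eq_or_lt with h | h
    · rw [← h, hx0, hy0]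
    have hlift : ∀ t ∈ Ioo 0 s, t ∈ Ioc 0 S := fun t ht => ⟨ht.1, ht.2.le.trans hs.2⟩
    have hP : ∀ t ∈ Ioo 0 s, 0 < -p (x t) := fun t ht =>
      neg_pos.mpr (hp _ (hx t (hi₁ t (hlift t ht))).1)
    have hQ : ∀ t ∈ Ioo 0 s, 0 < -q (y t) := fun t ht =>
      neg_pos.mpr (hq _ (hy t (hi₂ t (hlift t ht))).1)
    have hX := fun t (ht : t ∈ Ioo 0 s) => (hx t (hi₁ t (hlift t ht))).2.2.1
    have hY := fun t (ht : t ∈ Ioo 0 s) => (hy t (hi₂ t (hlift t ht))).2.2.1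
    have h1 := level_time_le (E := 1) h le_rfl hr₀ hxc.continuousOn hyc.continuousOn hx0 hy0
      hP hQ hX hY (fun t ht => by rw [one_mul]; exact (hqq t (hlift t ht)).ge)
    have h2 := level_time_le (E := 1) h le_rfl hr₀ hyc.continuousOn hxc.continuousOn hy0 hx0
      hQ hP hY hX (fun t ht => by rw [one_mul]; exact (hqq t (hlift t ht)).le)
    linarith
  refine ⟨x S - r₀, ?_, fun r hr => ?_⟩
  · rw [← hx0]; exact sub_pos.mpr (hxm hSp)
  · rcases hr.1.eq_or_lt with h | h
    · rw [← h, h0]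
    · obtain ⟨s, hs, rfl⟩ : r ∈ x '' Icc 0 S := by
        apply intermediate_value_Icc hSp.le hxc.continuousOn
        rw [hx0]; exact ⟨hr.1, by linarith [hr.2]⟩
      have hs0 : s ∈ Ioc 0 S := by
        refine ⟨?_, hs.2⟩
        rw [← hx0] at h; exact hxm.lt_iff_lt.mp h
      rw [(hx s (hi₁ s hs0)).2.1, hxy s hs, (hy s (hi₂ s hs0)).2.1, h0]

theorem SolvesOn.eventually_of_turning {n κ : ℝ} {f u p : ℝ → ℝ} {r₀ δ : ℝ} (hδ : 0 < δ)
    (hκ : 0 < κ) (hu : SolvesOn n f u p (Ioo r₀ (r₀ + δ)))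
    (huc : ContinuousWithinAt u (Ici r₀) r₀) (hp : Tendsto p (𝓝[>] r₀) (𝓝 0))
    (hp' : Tendsto (fun r => -(n / r) * p r - f (u r)) (𝓝[>] r₀) (𝓝 (-κ))) :
    (∀ᶠ r in 𝓝[>] r₀, p r < 0 ∧ -(n / r) * p r - f (u r) ≤ 0) ∧
      Tendsto (fun r => p r ^ 2 / (u r₀ - u r) ^ 1) (𝓝[>] r₀) (𝓝 (2 * κ)) := by
  have hmem : ∀ᶠ r in 𝓝[>] r₀, r ∈ Ioo r₀ (r₀ + δ) := Ioo_mem_nhdsGT (by linarith)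
  have h1 := hp'.eventually_lt_const (neg_neg_of_pos hκ)
  obtain ⟨c, hc, hcs⟩ := (mem_nhdsGT_iff_exists_Ioo_subset).mp (hmem.and h1)
  have hpn : ∀ r ∈ Ioo r₀ c, p r < 0 := by
    intro r hr
    have hm : StrictAntiOn p (Ioo r₀ c) := by
      apply strictAntiOn_of_deriv_neg (convex_Ioo _ _)
      · intro t ht; exact (hu t (hcs ht).1).2.continuousAt.continuousWithinAt
      · rw [interior_Ioo]
        intro t ht
        rw [(hu t (hcs ht).1).2.deriv]; exact (hcs ht).2
    obtain ⟨m, hm1, hm2⟩ := exists_between hr.1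
    have hmI : m ∈ Ioo r₀ c := ⟨hm1, hm2.trans hr.2⟩
    have h2 : p m ≤ 0 := by
      refine ge_of_tendsto hp ?_
      filter_upwards [Ioo_mem_nhdsGT hm1] with t ht
      exact (hm ⟨ht.1, ht.2.trans hmI.2⟩ hmI ht.2).le
    exact (hm hmI hr hm2).trans_le h2
  have hev : ∀ᶠ r in 𝓝[>] r₀, p r < 0 ∧ -(n / r) * p r - f (u r) ≤ 0 := by
    filter_upwards [Ioo_mem_nhdsGT hc] with r hr
    exact ⟨hpn r hr, (hcs hr).2.le⟩
  refine ⟨hev, ?_⟩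
  simp only [pow_one]
  refine HasDerivAt.lhopital_zero_nhdsGT (f' := fun r => 2 * p r * (-(n / r) * p r - f (u r)))
    (g' := fun r => -p r) ?_ ?_ ?_ ?_ ?_ ?_
  · filter_upwards [hmem] with r hr
    exact ((hu r hr).2.fun_pow 2).congr_deriv (by push_cast; ring)
  · filter_upwards [hmem] with r hr
    exact (hu r hr).1.const_sub _
  · filter_upwards [hev] with r hr
    linarith [hr.1]
  · simpa using hp.pow 2
  · have h2 : Tendsto u (𝓝[>] r₀) (𝓝 (u r₀)) := huc.mono_left (nhdsWithin_mono _ Ioi_subset_Ici_self)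
    simpa using h2.const_sub (u r₀)
  · have h2 := hp'.const_mul (-2)
    have h3 : -2 * -κ = 2 * κ := by ring
    rw [h3] at h2
    refine h2.congr' ?_
    filter_upwards [hev] with r hr
    have : p r ≠ 0 := hr.1.ne
    field_simp

theorem SolvesOn.eq_right_of_turning {n κ : ℝ} {f u p v q : ℝ → ℝ} {r₀ δ : ℝ} (hn : 0 ≤ n)
    (hr₀ : 0 ≤ r₀) (hδ : 0 < δ) (hκ : 0 < κ)
    (hu : SolvesOn n f u p (Ioo r₀ (r₀ + δ))) (hv : SolvesOn n f v q (Ioo r₀ (r₀ + δ)))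
    (huc : ContinuousWithinAt u (Ici r₀) r₀) (hvc : ContinuousWithinAt v (Ici r₀) r₀)
    (h0 : u r₀ = v r₀) (hp : Tendsto p (𝓝[>] r₀) (𝓝 0)) (hq : Tendsto q (𝓝[>] r₀) (𝓝 0))
    (hp' : Tendsto (fun r => -(n / r) * p r - f (u r)) (𝓝[>] r₀) (𝓝 (-κ)))
    (hq' : Tendsto (fun r => -(n / r) * q r - f (v r)) (𝓝[>] r₀) (𝓝 (-κ))) :
    ∃ δ' > 0, ∀ r ∈ Icc r₀ (r₀ + δ'), u r = v r := by
  obtain ⟨he₁, hl₁⟩ := hu.eventually_of_turning hδ hκ huc hp hp'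
  obtain ⟨he₂, hl₂⟩ := hv.eventually_of_turning hδ hκ hvc hq hq'
  have hmem : ∀ᶠ r in 𝓝[>] r₀, r ∈ Ioo r₀ (r₀ + δ) := Ioo_mem_nhdsGT (by linarith)
  obtain ⟨c, hc, hcs⟩ := (mem_nhdsGT_iff_exists_Ioo_subset).mp ((hmem.and he₁).and he₂)
  have hc' : r₀ + (c - r₀) = c := by ring
  refine SolvesOn.eq_right_of_neg (f := f) (δ := c - r₀) (K := 0) (ℓ := 2 * κ) (j := 1) hn hr₀ le_rfl
    (sub_pos.mpr hc) ?_ ?_ huc hvc h0 ?_ ?_ ?_ ?_ (by positivity) hl₁ hl₂ <;> rw [hc']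
  · exact hu.mono fun r hr => (hcs hr).1.1
  · exact hv.mono fun r hr => (hcs hr).1.1
  · exact fun r hr => (hcs hr).1.2.1
  · exact fun r hr => (hcs hr).2.1
  · exact fun r hr => by rw [zero_mul]; exact (hcs hr).1.2.2
  · exact fun r hr => by rw [zero_mul]; exact (hcs hr).2.2

theorem SolvesOn.continuousAt_deriv {n : ℝ} {f u p : ℝ → ℝ} {r₀ : ℝ} (hf : Continuous f)
    (hr₀ : 0 < r₀) (hu : SolvesOn n f u p (Ioi 0)) :
    ContinuousAt (fun r => -(n / r) * p r - f (u r)) r₀ :=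
  (((continuousAt_const.div continuousAt_id hr₀.ne').neg).mul (hu r₀ hr₀).2.continuousAt).sub
    (hf.continuousAt.comp (hu r₀ hr₀).1.continuousAt)

theorem SolvesOn.eq_right_of_deriv_neg {n : ℝ} {f u p v q : ℝ → ℝ} {r₀ : ℝ} (hn : 0 ≤ n)
    (hf : Continuous f) (hr₀ : 0 < r₀)
    (hu : SolvesOn n f u p (Ioi 0)) (hv : SolvesOn n f v q (Ioi 0))
    (h0 : u r₀ = v r₀) (h0' : p r₀ = q r₀) (hneg : p r₀ < 0) :
    ∃ δ' > 0, ∀ r ∈ Icc r₀ (r₀ + δ'), u r = v r := by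
  set K : ℝ := |-(n / r₀) * p r₀ - f (u r₀)| / p r₀ ^ 2 + 1 with hK
  have hp2 : 0 < p r₀ ^ 2 := sq_pos_of_neg hneg
  have hKlt : -(n / r₀) * p r₀ - f (u r₀) < K * p r₀ ^ 2 := by
    have : K * p r₀ ^ 2 = |-(n / r₀) * p r₀ - f (u r₀)| + p r₀ ^ 2 := by
      rw [hK, add_mul, div_mul_cancel₀ _ hp2.ne', one_mul]
    rw [this]
    linarith [le_abs_self (-(n / r₀) * p r₀ - f (u r₀))]
  have hev : ∀ (w g : ℝ → ℝ), SolvesOn n f w g (Ioi 0) → w r₀ = u r₀ → g r₀ = p r₀ →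
      ∀ᶠ r in 𝓝[>] r₀, g r < 0 ∧ -(n / r) * g r - f (w r) ≤ K * g r ^ 2 := by
    intro w g hw h1 h2
    have hg := (hw r₀ hr₀).2.continuousAt
    have h3 : ∀ᶠ r in 𝓝 r₀, g r < 0 := hg.eventually_lt_const (by rw [h2]; exact hneg)
    have h4 : ∀ᶠ r in 𝓝 r₀, -(n / r) * g r - f (w r) < K * g r ^ 2 := by
      refine (hw.continuousAt_deriv hf hr₀).eventually_lt (continuousAt_const.mul (hg.pow 2)) ?_
      simp only [h1, h2]; exact hKlt
    refine Filter.Eventually.filter_mono nhdsWithin_le_nhds ?_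
    filter_upwards [h3, h4] with r ha hb using ⟨ha, hb.le⟩
  obtain ⟨c, hc, hcs⟩ := (mem_nhdsGT_iff_exists_Ioo_subset).mp
    ((hev u p hu rfl rfl).and (hev v q hv h0.symm h0'.symm))
  have hc' : r₀ + (c - r₀) = c := by ring
  have hlim : ∀ (w g : ℝ → ℝ), SolvesOn n f w g (Ioi 0) → g r₀ = p r₀ →
      Tendsto (fun r => g r ^ 2 / (w r₀ - w r) ^ 0) (𝓝[>] r₀) (𝓝 (p r₀ ^ 2)) := by
    intro w g hw h2
    simp only [pow_zero, div_one]
    rw [← h2]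
    exact ((hw r₀ hr₀).2.continuousAt.pow 2).tendsto.mono_left nhdsWithin_le_nhds
  have hsub : Ioo r₀ c ⊆ Ioi 0 := fun r hr => hr₀.trans hr.1
  refine SolvesOn.eq_right_of_neg (f := f) (δ := c - r₀) (K := K) (j := 0) hn hr₀.le (by positivity)
    (sub_pos.mpr hc) ?_ ?_ (hu r₀ hr₀).1.continuousAt.continuousWithinAt
    (hv r₀ hr₀).1.continuousAt.continuousWithinAt h0 ?_ ?_ ?_ ?_ hp2 (hlim u p hu rfl)
    (hlim v q hv h0'.symm) <;> rw [hc']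
  · exact hu.mono hsub
  · exact hv.mono hsub
  · exact fun r hr => (hcs hr).1.1
  · exact fun r hr => (hcs hr).2.1
  · exact fun r hr => (hcs hr).1.2
  · exact fun r hr => (hcs hr).2.2

/-- Local forward uniqueness at a point which is not an equilibrium. -/
theorem SolvesOn.eq_right {n : ℝ} {f u p v q : ℝ → ℝ} {r₀ : ℝ} (hn : 0 ≤ n)
    (hf : Continuous f) (hodd : ∀ x, f (-x) = -f x) (hr₀ : 0 < r₀)
    (hu : SolvesOn n f u p (Ioi 0)) (hv : SolvesOn n f v q (Ioi 0))
    (h0 : u r₀ = v r₀) (h0' : p r₀ = q r₀) (hne : p r₀ ≠ 0 ∨ f (u r₀) ≠ 0) :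
    ∃ δ' > 0, ∀ r ∈ Icc r₀ (r₀ + δ'), u r = v r := by
  have turning : ∀ (u p v q : ℝ → ℝ), SolvesOn n f u p (Ioi 0) → SolvesOn n f v q (Ioi 0) →
      u r₀ = v r₀ → p r₀ = q r₀ → p r₀ = 0 → 0 < f (u r₀) →
      ∃ δ' > 0, ∀ r ∈ Icc r₀ (r₀ + δ'), u r = v r := by
    intro u p v q hu hv h0 h0' hp0 hfu
    have hsub : Ioo r₀ (r₀ + 1) ⊆ Ioi 0 := fun r hr => hr₀.trans hr.1
    have h1 := (hu.continuousAt_deriv hf hr₀).tendsto.mono_left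
      (nhdsWithin_le_nhds (s := Ioi r₀))
    have h2 := (hv.continuousAt_deriv hf hr₀).tendsto.mono_left
      (nhdsWithin_le_nhds (s := Ioi r₀))
    have h3 := (hu r₀ hr₀).2.continuousAt.tendsto.mono_left (nhdsWithin_le_nhds (s := Ioi r₀))
    have h4 := (hv r₀ hr₀).2.continuousAt.tendsto.mono_left (nhdsWithin_le_nhds (s := Ioi r₀))
    rw [hp0] at h1 h3
    rw [← h0', ← h0, hp0] at h2
    rw [← h0', hp0] at h4
    simp only [mul_zero, zero_sub] at h1 h2
    exact SolvesOn.eq_right_of_turning hn hr₀.le one_pos hfu (hu.mono hsub) (hv.mono hsub)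
      (hu r₀ hr₀).1.continuousAt.continuousWithinAt (hv r₀ hr₀).1.continuousAt.continuousWithinAt
      h0 h3 h4 h1 h2
  have hu' := hu.neg hodd
  have hv' := hv.neg hodd
  rcases lt_trichotomy (p r₀) 0 with h | h | h
  · exact hu.eq_right_of_deriv_neg hn hf hr₀ hv h0 h0' h
  · rcases lt_or_gt_of_ne (hne.resolve_left (not_not.mpr h)) with h1 | h1
    · obtain ⟨d, hd, heq⟩ := turning _ _ _ _ hu' hv' (by simp [h0]) (by simp [h0']) (by simp [h])
        (by rw [hodd]; linarith)
      exact ⟨d, hd, fun r hr => neg_injective (heq r hr)⟩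
    · exact turning _ _ _ _ hu hv h0 h0' h h1
  · obtain ⟨d, hd, heq⟩ := hu'.eq_right_of_deriv_neg hn hf hr₀ hv' (by simp [h0]) (by simp [h0'])
      (by linarith)
    exact ⟨d, hd, fun r hr => neg_injective (heq r hr)⟩

/-- Local uniqueness at the origin. -/
theorem SolvesOn.eq_right_zero {n : ℝ} {f u p v q : ℝ → ℝ} (hn : 0 ≤ n)
    (hf : Continuous f) (hodd : ∀ x, f (-x) = -f x)
    (hu : SolvesOn n f u p (Ioi 0)) (hv : SolvesOn n f v q (Ioi 0))
    (huc : ContinuousWithinAt u (Ici 0) 0) (hvc : ContinuousWithinAt v (Ici 0) 0)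
    (h0 : u 0 = v 0)
    (hp : Tendsto (fun r => p r / r) (𝓝[>] 0) (𝓝 (-f (u 0) / (n + 1))))
    (hq : Tendsto (fun r => q r / r) (𝓝[>] 0) (𝓝 (-f (v 0) / (n + 1))))
    (hne : f (u 0) ≠ 0) :
    ∃ δ' > 0, ∀ r ∈ Icc 0 δ', u r = v r := by
  have aux : ∀ (u p : ℝ → ℝ), ContinuousWithinAt u (Ici 0) 0 →
      Tendsto (fun r => p r / r) (𝓝[>] 0) (𝓝 (-f (u 0) / (n + 1))) →
      Tendsto p (𝓝[>] 0) (𝓝 0) ∧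
        Tendsto (fun r => -(n / r) * p r - f (u r)) (𝓝[>] 0) (𝓝 (-(f (u 0) / (n + 1)))) := by
    intro u p huc hp
    constructor
    · have h1 : Tendsto (fun r : ℝ => r) (𝓝[>] 0) (𝓝 0) :=
        tendsto_id.mono_left nhdsWithin_le_nhds
      have h2 := hp.mul h1
      rw [mul_zero] at h2
      refine h2.congr' ?_
      filter_upwards [self_mem_nhdsWithin] with r hr
      have : r ≠ 0 := (show 0 < r from hr).ne'
      field_simp
    · have h1 : Tendsto (fun r => f (u r)) (𝓝[>] 0) (𝓝 (f (u 0))) :=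
        (hf.tendsto _).comp (huc.mono_left (nhdsWithin_mono _ Ioi_subset_Ici_self))
      have h2 := (hp.const_mul (-n)).sub h1
      have h3 : -n * (-f (u 0) / (n + 1)) - f (u 0) = -(f (u 0) / (n + 1)) := by
        have : n + 1 ≠ 0 := by linarith
        field_simp; ring
      rw [h3] at h2
      refine h2.congr fun r => ?_
      ring
  have main : ∀ (u p v q : ℝ → ℝ), SolvesOn n f u p (Ioi 0) → SolvesOn n f v q (Ioi 0) →
      ContinuousWithinAt u (Ici 0) 0 → ContinuousWithinAt v (Ici 0) 0 → u 0 = v 0 →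
      Tendsto (fun r => p r / r) (𝓝[>] 0) (𝓝 (-f (u 0) / (n + 1))) →
      Tendsto (fun r => q r / r) (𝓝[>] 0) (𝓝 (-f (v 0) / (n + 1))) → 0 < f (u 0) →
      ∃ δ' > 0, ∀ r ∈ Icc 0 δ', u r = v r := by
    intro u p v q hu hv huc hvc h0 hp hq hpos
    obtain ⟨h1, h2⟩ := aux u p huc hp
    obtain ⟨h3, h4⟩ := aux v q hvc hq
    rw [← h0] at h4
    have hsub : Ioo 0 (0 + 1 : ℝ) ⊆ Ioi 0 := fun r hr => hr.1
    have := SolvesOn.eq_right_of_turning hn le_rfl one_pos (by positivity : 0 < f (u 0) / (n + 1))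
      (hu.mono hsub) (hv.mono hsub) huc hvc h0 h1 h3 h2 h4
    simpa using this
  rcases lt_or_gt_of_ne hne with h | h
  · have negl : ∀ (u p : ℝ → ℝ), Tendsto (fun r => p r / r) (𝓝[>] 0) (𝓝 (-f (u 0) / (n + 1))) →
        Tendsto (fun r => -p r / r) (𝓝[>] 0) (𝓝 (-f (-u 0) / (n + 1))) := by
      intro u p hp
      have h1 := hp.neg
      rw [hodd]
      have h2 : - -f (u 0) / (n + 1) = -(-f (u 0) / (n + 1)) := by ring
      rw [h2]
      exact h1.congr fun r => by ring
    obtain ⟨d, hd, heq⟩ := main _ _ _ _ (hu.neg hodd) (hv.neg hodd) huc.neg hvc.neg (by simp [h0])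
      (negl u p hp) (negl v q hq) (by rw [hodd]; linarith)
    exact ⟨d, hd, fun r hr => neg_injective (heq r hr)⟩
  · exact main _ _ _ _ hu hv huc hvc h0 hp hq h

/-- Uniqueness up to time `R` as long as no equilibrium is met. -/
theorem SolvesOn.unique {n R : ℝ} {f u p v q : ℝ → ℝ} (hn : 0 ≤ n)
    (hf : Continuous f) (hodd : ∀ x, f (-x) = -f x)
    (hu : SolvesOn n f u p (Ioi 0)) (hv : SolvesOn n f v q (Ioi 0))
    (huc : ContinuousWithinAt u (Ici 0) 0) (hvc : ContinuousWithinAt v (Ici 0) 0)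
    (h0 : u 0 = v 0)
    (hp : Tendsto (fun r => p r / r) (𝓝[>] 0) (𝓝 (-f (u 0) / (n + 1))))
    (hq : Tendsto (fun r => q r / r) (𝓝[>] 0) (𝓝 (-f (v 0) / (n + 1))))
    (hne : f (u 0) ≠ 0) (hR : ∀ r ∈ Ioc 0 R, p r ≠ 0 ∨ f (u r) ≠ 0) :
    ∀ r ∈ Ioc 0 R, u r = v r ∧ p r = q r := by
  obtain ⟨d, hd, heq⟩ := hu.eq_right_zero hn hf hodd hv huc hvc h0 hp hq hne
  have hderiv : ∀ a c : ℝ, 0 ≤ a → (∀ r ∈ Icc a c, u r = v r) →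
      ∀ r ∈ Ioo a c, u r = v r ∧ p r = q r := by
    intro a c ha h r hr
    have hr0 : 0 < r := ha.trans_lt hr.1
    refine ⟨h r ⟨hr.1.le, hr.2.le⟩, ?_⟩
    refine (hu r hr0).1.unique ((hv r hr0).1.congr_of_eventuallyEq ?_)
    filter_upwards [Ioo_mem_nhds hr.1 hr.2] with t ht
    exact h t ⟨ht.1.le, ht.2.le⟩
  intro r hr
  rcases lt_or_ge r d with hrd | hrd
  · exact hderiv 0 d le_rfl heq r ⟨hr.1, hrd⟩
  have hsub : Icc (d / 2) R ⊆ Ioi 0 := fun t ht => by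
    have := ht.1; simp only [mem_Ioi]; linarith
  have hcl : IsClosed ({t | u t = v t ∧ p t = q t} ∩ Icc (d / 2) R) := by
    have hc : ∀ g₁ g₂ : ℝ → ℝ, ContinuousOn g₁ (Icc (d / 2) R) → ContinuousOn g₂ (Icc (d / 2) R) →
        IsClosed (Icc (d / 2) R ∩ {t | g₁ t = g₂ t}) := by
      intro g₁ g₂ h1 h2
      have := (h1.sub h2).preimage_isClosed_of_isClosed isClosed_Icc (isClosed_singleton (x := 0))
      convert this using 2
      ext t; simp [sub_eq_zero]
    have h1 := hc u v (fun t ht => (hu t (hsub ht)).1.continuousAt.continuousWithinAt)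
      (fun t ht => (hv t (hsub ht)).1.continuousAt.continuousWithinAt)
    have h2 := hc p q (fun t ht => (hu t (hsub ht)).2.continuousAt.continuousWithinAt)
      (fun t ht => (hv t (hsub ht)).2.continuousAt.continuousWithinAt)
    convert h1.inter h2 using 1
    ext t
    simp only [mem_inter_iff, mem_ofPred_eq]
    tauto
  refine hcl.Icc_subset_of_forall_mem_nhdsWithin
    (hderiv 0 d le_rfl heq _ ⟨by linarith, by linarith⟩) ?_ ⟨by linarith, hr.2⟩
  rintro t ⟨⟨h1, h2⟩, h3⟩
  have ht0 : 0 < t := hsub ⟨h3.1, h3.2.le⟩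
  obtain ⟨e, he, heq'⟩ := hu.eq_right hn hf hodd ht0 hv h1 h2 (hR t ⟨ht0, h3.2.le⟩)
  refine mem_of_superset (Ioo_mem_nhdsGT (show t < t + e by linarith)) fun s hs => ?_
  exact hderiv t (t + e) ht0.le heq' s hs

theorem H1.continuous {f : ℝ → ℝ} {b β : ℝ} (h : H1 f b β) : Continuous f := by
  obtain ⟨hc, -, -, -, -, -, -, hodd, -⟩ := h
  have h1 : ContinuousOn f (Iic 0) := by
    have h2 : ContinuousOn (fun x => -f (-x)) (Iic 0) :=
      (hc.comp continuousOn_neg (fun x hx => by simpa using hx)).neg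
    exact h2.congr fun x _ => show f x = -f (-x) by rw [hodd, neg_neg]
  have h3 := h1.union_of_isClosed hc isClosed_Iic isClosed_Ici
  rwa [Iic_union_Ici, continuousOn_univ] at h3

theorem hasDerivAt_Fint {f : ℝ → ℝ} (hf : Continuous f) (s : ℝ) : HasDerivAt (Fint f) (f s) s :=
  (hf.integral_hasStrictDerivAt 0 s).hasDerivAt

theorem continuous_Fint {f : ℝ → ℝ} (hf : Continuous f) : Continuous (Fint f) :=
  continuous_iff_continuousAt.mpr fun s => (hasDerivAt_Fint hf s).continuousAt

theorem Fint_zero (f : ℝ → ℝ) : Fint f 0 = 0 := by simp [Fint]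

theorem Fint_neg {f : ℝ → ℝ} (hodd : ∀ x, f (-x) = -f x) (s : ℝ) : Fint f (-s) = Fint f s := by
  have h := intervalIntegral.integral_comp_neg (a := 0) (b := s) f
  simp only [hodd, neg_zero, intervalIntegral.integral_neg] at h
  rw [Fint, Fint, intervalIntegral.integral_symm, ← h, neg_neg]

theorem Fint_abs {f : ℝ → ℝ} (hodd : ∀ x, f (-x) = -f x) (s : ℝ) : Fint f |s| = Fint f s := by
  rcases abs_choice s with h | h <;> rw [h]
  exact Fint_neg hodd s

theorem H1.b_pos {f : ℝ → ℝ} {b β : ℝ} (h : H1 f b β) : 0 < b := by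
  obtain ⟨-, -, -, hb, hpos, -, ⟨ε, hε, hneg⟩, -⟩ := h
  by_contra hb'
  have h1 := hpos (ε / 2) (by linarith)
  have h2 := hneg (ε / 2) ⟨by linarith, by linarith⟩
  linarith

theorem H1.strictMonoOn_Fint {f : ℝ → ℝ} {b β : ℝ} (h : H1 f b β) :
    StrictMonoOn (Fint f) (Ici b) := by
  have hf := h.continuous
  apply strictMonoOn_of_deriv_pos (convex_Ici b) (continuous_Fint hf).continuousOn
  rw [interior_Ici]
  intro x hx
  rw [(hasDerivAt_Fint hf x).deriv]
  exact h.2.2.2.2.1 x hx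

theorem H1.Fint_neg_of_mem {f : ℝ → ℝ} {b β s : ℝ} (h : H1 f b β) (h0 : 0 < s) (hs : s < β) :
    Fint f s < 0 := by
  have hf := h.continuous
  have hm := h.strictMonoOn_Fint
  obtain ⟨-, -, -, hb, -, hnp, ⟨ε, hε, hneg⟩, -, hbβ, hβ, -⟩ := h
  rcases le_or_gt b s with hbs | hbs
  · rw [← hβ]; exact hm hbs hbβ hs
  have h1 : StrictAntiOn (Fint f) (Icc 0 ε) := by
    apply strictAntiOn_of_deriv_neg (convex_Icc 0 ε) (continuous_Fint hf).continuousOn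
    rw [interior_Icc]
    intro x hx
    rw [(hasDerivAt_Fint hf x).deriv]
    exact hneg x hx
  have h2 : AntitoneOn (Fint f) (Icc 0 b) := by
    apply antitoneOn_of_deriv_nonpos (convex_Icc 0 b) (continuous_Fint hf).continuousOn
    · exact fun x _ => (hasDerivAt_Fint hf x).differentiableAt.differentiableWithinAt
    · intro x hx
      rw [(hasDerivAt_Fint hf x).deriv]
      exact hnp x (interior_subset hx)
  have hp : 0 < min s ε := lt_min h0 hε
  calc Fint f s ≤ Fint f (min s ε) :=
        h2 ⟨hp.le, (min_le_left _ _).trans hbs.le⟩ ⟨h0.le, hbs.le⟩ (min_le_left _ _)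
    _ < Fint f 0 := h1 ⟨le_rfl, hε.le⟩ ⟨hp.le, min_le_right _ _⟩ hp
    _ = 0 := Fint_zero f

theorem H1.odd {f : ℝ → ℝ} {b β : ℝ} (h : H1 f b β) : ∀ x, f (-x) = -f x := h.2.2.2.2.2.2.2.1

theorem H1.b_lt {f : ℝ → ℝ} {b β : ℝ} (h : H1 f b β) : b < β := by
  obtain ⟨-, -, -, hb, -, hnp, -, -, hbβ, hβ, -⟩ := id h
  rcases hbβ.eq_or_lt with h1 | h1
  · exfalso
    have h2 : Fint f (b / 2) < 0 := h.Fint_neg_of_mem (by linarith [h.b_pos]) (by linarith [h.b_pos])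
    have h3 : AntitoneOn (Fint f) (Icc 0 b) := by
      apply antitoneOn_of_deriv_nonpos (convex_Icc 0 b) (continuous_Fint h.continuous).continuousOn
      · exact fun x _ => (hasDerivAt_Fint h.continuous x).differentiableAt.differentiableWithinAt
      · intro x hx
        rw [(hasDerivAt_Fint h.continuous x).deriv]
        exact hnp x (interior_subset hx)
    have h4 := h3 (show b / 2 ∈ Icc 0 b from ⟨by linarith, by linarith⟩) (right_mem_Icc.mpr hb)
      (by linarith)
    rw [h1, hβ, ← h1] at h4
    linarith
  · exact h1

theorem H1.Fint_nonpos {f : ℝ → ℝ} {b β s : ℝ} (h : H1 f b β) (hs : |s| ≤ β) : Fint f s ≤ 0 := by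
  rw [← Fint_abs h.odd]
  rcases (abs_nonneg s).eq_or_lt with h0 | h0
  · rw [← h0, Fint_zero]
  · rcases hs.eq_or_lt with h1 | h1
    · rw [h1, h.2.2.2.2.2.2.2.2.2.1]
    · exact (h.Fint_neg_of_mem h0 h1).le

theorem H1.eq_zero_or_le_abs {f : ℝ → ℝ} {b β s : ℝ} (h : H1 f b β) (hs : 0 ≤ Fint f s) :
    s = 0 ∨ β ≤ |s| := by
  by_contra! hcon
  rw [← Fint_abs h.odd] at hs
  exact absurd (h.Fint_neg_of_mem (abs_pos.mpr hcon.1) hcon.2) (not_lt.mpr hs)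

theorem H1.apply_ne_zero {f : ℝ → ℝ} {b β s : ℝ} (h : H1 f b β) (hs : b < |s|) : f s ≠ 0 := by
  have h1 := h.2.2.2.2.1 _ hs
  intro h2
  rcases abs_choice s with h3 | h3 <;> rw [h3] at h1
  · linarith
  · rw [h.odd] at h1; linarith

theorem IsRadialSol.solvesOn {N : ℕ} {f u : ℝ → ℝ} (h : IsRadialSol N f u) :
    SolvesOn ((N : ℝ) - 1) f u (deriv u) (Ioi 0) := by
  intro r hr
  obtain ⟨h1, h2, h3⟩ := h.2.2 r hr
  refine ⟨h1.hasDerivAt, h2.hasDerivAt.congr_deriv ?_⟩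
  linarith

theorem SolvesOn.deriv_le_near_zero {m : ℕ} (hm : 0 < m) {f u p : ℝ → ℝ} {c r : ℝ}
    (hu : SolvesOn m f u p (Ioi 0)) (hu0 : HasDerivWithinAt u 0 (Ici 0) 0) (hr : 0 < r)
    (hc : ∀ t ∈ Ioo 0 r, c ≤ f (u t)) : p r ≤ -c * r / (m + 1) := by
  set g : ℝ → ℝ := fun t => t ^ m * p t + c * t ^ (m + 1) / (m + 1) with hg
  have hgd : ∀ t, 0 < t → HasDerivAt g (t ^ m * (c - f (u t))) t := by
    intro t ht
    have h1 := ((hasDerivAt_pow m t).mul (hu t ht).2).add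
      (((hasDerivAt_pow (m + 1) t).const_mul c).div_const ((m : ℝ) + 1))
    refine h1.congr_deriv ?_
    have h2 : (m : ℝ) + 1 ≠ 0 := by positivity
    obtain ⟨k, rfl⟩ : ∃ k, m = k + 1 := ⟨m - 1, by omega⟩
    simp only [Nat.add_sub_cancel]
    push_cast at h2 ⊢
    field_simp
    ring
  have hanti : AntitoneOn g (Ioc 0 r) := by
    apply antitoneOn_of_deriv_nonpos (convex_Ioc 0 r)
    · exact fun t ht => (hgd t ht.1).continuousAt.continuousWithinAt
    · rw [interior_Ioc]
      exact fun t ht => (hgd t ht.1).differentiableAt.differentiableWithinAt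
    · rw [interior_Ioc]
      intro t ht
      rw [(hgd t ht.1).deriv]
      have := hc t ht
      exact mul_nonpos_of_nonneg_of_nonpos (pow_nonneg ht.1.le m) (by linarith)
  have hgr : g r ≤ 0 := by
    by_contra! hη
    have h1 : Tendsto (fun t : ℝ => t ^ m + c * t ^ (m + 1) / (m + 1)) (𝓝[>] 0) (𝓝 0) := by
      have : Continuous (fun t : ℝ => t ^ m + c * t ^ (m + 1) / (m + 1)) := by fun_prop
      have h2 := this.tendsto 0
      simp only [ne_eq, hm.ne', not_false_eq_true, zero_pow, Nat.add_eq_zero_iff, one_ne_zero,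
        and_false, mul_zero, zero_div, add_zero] at h2
      exact h2.mono_left nhdsWithin_le_nhds
    have h2 : ∀ᶠ t in 𝓝[>] (0 : ℝ), t ^ m + c * t ^ (m + 1) / (m + 1) < g r ∧ t < r :=
      (h1.eventually_lt_const hη).and (nhdsWithin_le_nhds (Iio_mem_nhds hr))
    obtain ⟨d, hd, hds⟩ := (mem_nhdsGT_iff_exists_Ioo_subset).mp h2
    have h3 : ∀ᶠ x in 𝓝[>] (0 : ℝ), slope u 0 x < 1 ∧ x < d := by
      have h4 := (hasDerivWithinAt_iff_tendsto_slope.mp hu0)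
      rw [Ici_sdiff_left] at h4
      exact (h4.eventually_lt_const one_pos).and (nhdsWithin_le_nhds (Iio_mem_nhds hd))
    obtain ⟨x, ⟨hx1, hx2⟩, hx0⟩ := (h3.and self_mem_nhdsWithin).exists
    have hx0 : 0 < x := hx0
    obtain ⟨ξ, hξ, hξs⟩ := exists_hasDerivAt_eq_slope u p hx0
      (fun t ht => by
        rcases ht.1.eq_or_lt with h | h
        · rw [← h]; exact hu0.continuousWithinAt.mono Icc_subset_Ici_self
        · exact (hu t h).1.continuousAt.continuousWithinAt)
      (fun t ht => (hu t ht.1).1)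
    rw [slope_def_field] at hx1
    rw [← hξs] at hx1
    have h5 := hds ⟨hξ.1, hξ.2.trans hx2⟩
    have h6 := hanti ⟨hξ.1, h5.2.le⟩ ⟨hr, le_rfl⟩ h5.2.le
    have h7 : ξ ^ m * p ξ ≤ ξ ^ m * 1 := mul_le_mul_of_nonneg_left hx1.le (pow_nonneg hξ.1.le m)
    have h8 := h5.1
    simp only [hg] at h6 h8
    linarith
  have hrm : 0 < r ^ m := by positivity
  have h1 : g r = r ^ m * (p r - -c * r / (m + 1)) := by
    simp only [hg]; rw [pow_succ]; ring
  rw [h1] at hgr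
  have := nonpos_of_mul_nonpos_right hgr hrm
  linarith

theorem SolvesOn.abs_deriv_add_le {m : ℕ} (hm : 0 < m) {f u p : ℝ → ℝ} {c M r : ℝ}
    (hodd : ∀ x, f (-x) = -f x)
    (hu : SolvesOn m f u p (Ioi 0)) (hu0 : HasDerivWithinAt u 0 (Ici 0) 0) (hr : 0 < r)
    (hc : ∀ t ∈ Ioo 0 r, |f (u t) - c| ≤ M) : |p r + c * r / (m + 1)| ≤ M * r / (m + 1) := by
  have h1 := hu.deriv_le_near_zero hm (c := c - M) hu0 hr
    (fun t ht => by linarith [(abs_le.mp (hc t ht)).1])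
  have h2 := (hu.neg hodd).deriv_le_near_zero hm (c := -c - M) (by simpa using hu0.fun_neg) hr
    (fun t ht => by rw [hodd]; linarith [(abs_le.mp (hc t ht)).2])
  have h3 : -(c - M) * r / (m + 1) = M * r / (m + 1) - c * r / (m + 1) := by ring
  have h4 : -(-c - M) * r / (m + 1) = M * r / (m + 1) + c * r / (m + 1) := by ring
  rw [abs_le]
  constructor <;> linarith

theorem SolvesOn.tendsto_deriv_div {m : ℕ} (hm : 0 < m) {f u p : ℝ → ℝ} (hf : Continuous f)
    (hodd : ∀ x, f (-x) = -f x)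
    (hu : SolvesOn m f u p (Ioi 0)) (hu0 : HasDerivWithinAt u 0 (Ici 0) 0) :
    Tendsto (fun r => p r / r) (𝓝[>] 0) (𝓝 (-f (u 0) / (m + 1))) := by
  have hc : Tendsto (fun r => f (u r)) (𝓝[>] 0) (𝓝 (f (u 0))) :=
    (hf.tendsto _).comp (hu0.continuousWithinAt.mono_left (nhdsWithin_mono _ Ioi_subset_Ici_self))
  rw [Metric.tendsto_nhds]
  intro ε hε
  have h1 := (Metric.tendsto_nhds.mp hc) (ε / 2) (by positivity)
  obtain ⟨d, hd, hds⟩ := (mem_nhdsGT_iff_exists_Ioo_subset).mp h1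
  filter_upwards [Ioo_mem_nhdsGT hd] with r hr
  have h2 := hu.abs_deriv_add_le hm (c := f (u 0)) (M := ε / 2) hodd hu0 hr.1
    (fun t ht => (hds ⟨ht.1, ht.2.trans hr.2⟩).le)
  have hr0 := hr.1
  rw [Real.dist_eq]
  have h3 : p r / r - -f (u 0) / (m + 1) = (p r + f (u 0) * r / (m + 1)) / r := by
    field_simp; ring
  rw [h3, abs_div, abs_of_pos hr0, div_lt_iff₀ hr0]
  refine h2.trans_lt ?_
  calc ε / 2 * r / (m + 1) ≤ ε / 2 * r := div_le_self (by positivity) (by linarith [Nat.cast_nonneg (α := ℝ) m])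
    _ < ε * r := by nlinarith

/-- The energy `u'² / 2 + F(u)`. -/
noncomputable def radialEnergy (f u p : ℝ → ℝ) (r : ℝ) : ℝ := p r ^ 2 / 2 + Fint f (u r)

theorem SolvesOn.hasDerivAt_radialEnergy {n r : ℝ} {f u p : ℝ → ℝ} {s : Set ℝ} (hf : Continuous f)
    (hu : SolvesOn n f u p s) (hr : r ∈ s) :
    HasDerivAt (radialEnergy f u p) (-(n / r) * p r ^ 2) r := by
  have h1 := (((hu r hr).2.fun_pow 2).div_const 2).add
    ((hasDerivAt_Fint hf (u r)).comp r (hu r hr).1)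
  refine h1.congr_deriv ?_
  push_cast
  ring

theorem SolvesOn.antitoneOn_radialEnergy {n : ℝ} {f u p : ℝ → ℝ} (hn : 0 ≤ n) (hf : Continuous f)
    (hu : SolvesOn n f u p (Ioi 0)) : AntitoneOn (radialEnergy f u p) (Ioi 0) := by
  apply antitoneOn_of_deriv_nonpos (convex_Ioi 0)
  · exact fun r hr => (hu.hasDerivAt_radialEnergy hf hr).continuousAt.continuousWithinAt
  · intro r hr
    exact (hu.hasDerivAt_radialEnergy hf (interior_subset hr)).differentiableAt.differentiableWithinAt
  · intro r hr
    have hr' : 0 < r := interior_subset hr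
    rw [(hu.hasDerivAt_radialEnergy hf (interior_subset hr)).deriv]
    have : 0 ≤ n / r * p r ^ 2 := by positivity
    linarith

theorem SolvesOn.radialEnergy_le {m : ℕ} (hm : 0 < m) {f u p : ℝ → ℝ} {r : ℝ} (hf : Continuous f)
    (hodd : ∀ x, f (-x) = -f x) (hu : SolvesOn m f u p (Ioi 0))
    (hu0 : HasDerivWithinAt u 0 (Ici 0) 0) (hr : 0 < r) :
    radialEnergy f u p r ≤ Fint f (u 0) := by
  have h1 : Tendsto (fun r : ℝ => r) (𝓝[>] 0) (𝓝 0) := tendsto_id.mono_left nhdsWithin_le_nhds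
  have h2 := (hu.tendsto_deriv_div hm hf hodd hu0).mul h1
  have h3 : Tendsto p (𝓝[>] 0) (𝓝 0) := by
    rw [mul_zero] at h2
    refine h2.congr' ?_
    filter_upwards [self_mem_nhdsWithin] with r hr
    have : r ≠ 0 := (show 0 < r from hr).ne'
    field_simp
  have h4 : Tendsto (fun r => Fint f (u r)) (𝓝[>] 0) (𝓝 (Fint f (u 0))) :=
    ((continuous_Fint hf).tendsto _).comp
      (hu0.continuousWithinAt.mono_left (nhdsWithin_mono _ Ioi_subset_Ici_self))
  have h5 : Tendsto (radialEnergy f u p) (𝓝[>] 0) (𝓝 (Fint f (u 0))) := by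
    have := ((h3.pow 2).div_const 2).add h4
    have h6 : Tendsto (fun x => p x ^ 2 / 2 + Fint f (u x)) (𝓝[>] 0) (𝓝 (Fint f (u 0))) := by
      simpa using this
    exact h6
  refine ge_of_tendsto h5 ?_
  filter_upwards [Ioo_mem_nhdsGT hr] with t ht
  exact hu.antitoneOn_radialEnergy (Nat.cast_nonneg m) hf ht.1 hr ht.2.le

theorem SolvesOn.abs_le_abs_zero {m : ℕ} (hm : 0 < m) {f u p : ℝ → ℝ} {b β r : ℝ} (h : H1 f b β)
    (hu : SolvesOn m f u p (Ioi 0)) (hu0 : HasDerivWithinAt u 0 (Ici 0) 0) (hb : b ≤ |u 0|)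
    (hr : 0 < r) : |u r| ≤ |u 0| := by
  by_contra! hlt
  have h1 := hu.radialEnergy_le hm h.continuous h.odd hu0 hr
  have h2 := h.strictMonoOn_Fint hb (hb.trans hlt.le) hlt
  rw [Fint_abs h.odd, Fint_abs h.odd] at h2
  have h3 : 0 ≤ p r ^ 2 := sq_nonneg _
  simp only [radialEnergy] at h1
  linarith

theorem SolvesOn.antitoneOn_sq_mul_radialEnergy {n R S β b : ℝ} {f u p : ℝ → ℝ} (h : H1 f b β)
    (hn : 2 ≤ n) (hu : SolvesOn n f u p (Ioi 0)) (hR : 0 < R)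
    (hβ : ∀ r ∈ Ico R S, |u r| ≤ β) :
    AntitoneOn (fun r => r ^ 2 * radialEnergy f u p r) (Ico R S) := by
  have hd : ∀ r, 0 < r → HasDerivAt (fun r => r ^ 2 * radialEnergy f u p r)
      (r * (2 * Fint f (u r) - (n - 1) * p r ^ 2)) r := by
    intro r hr
    refine ((hasDerivAt_pow 2 r).fun_mul
      (hu.hasDerivAt_radialEnergy h.continuous hr)).congr_deriv ?_
    simp only [radialEnergy]
    push_cast
    field_simp
    ring
  apply antitoneOn_of_deriv_nonpos (convex_Ico R S)
  · exact fun r hr => (hd r (hR.trans_le hr.1)).continuousAt.continuousWithinAt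
  · exact fun r hr => (hd r (hR.trans_le (interior_subset hr).1)).differentiableAt.differentiableWithinAt
  · intro r hr
    have hr' := interior_subset hr
    have hr0 := hR.trans_le hr'.1
    rw [(hd r hr0).deriv]
    have h1 := h.Fint_nonpos (hβ r hr')
    have h2 : 0 ≤ (n - 1) * p r ^ 2 := mul_nonneg (by linarith) (sq_nonneg _)
    exact mul_nonpos_of_nonneg_of_nonpos hr0.le (by linarith)

theorem exists_crossing {g : ℝ → ℝ} {a c s₁ s₂ : ℝ} (hac : a ≤ c) (hg : ContinuousOn g (Icc a c))
    (hs : s₁ < s₂) (ha : g a ≤ s₁) (hc : s₂ ≤ g c) :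
    ∃ x y, a ≤ x ∧ x < y ∧ y ≤ c ∧ g x ≤ s₁ ∧ s₂ ≤ g y ∧ ∀ t ∈ Ioo x y, s₁ ≤ g t ∧ g t ≤ s₂ := by
  have hA : IsCompact (Icc a c ∩ g ⁻¹' Ici s₂) :=
    isCompact_Icc.of_isClosed_subset (hg.preimage_isClosed_of_isClosed isClosed_Icc isClosed_Ici)
      inter_subset_left
  obtain ⟨y, ⟨hy1, hy2⟩, hymin⟩ := hA.exists_isLeast ⟨c, ⟨hac, le_rfl⟩, hc⟩
  have hB : IsCompact (Icc a y ∩ g ⁻¹' Iic s₁) :=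
    isCompact_Icc.of_isClosed_subset
      ((hg.mono (Icc_subset_Icc_right hy1.2)).preimage_isClosed_of_isClosed isClosed_Icc isClosed_Iic)
      inter_subset_left
  obtain ⟨x, ⟨hx1, hx2⟩, hxmax⟩ := hB.exists_isGreatest ⟨a, ⟨le_rfl, hy1.1⟩, ha⟩
  have hx2 : g x ≤ s₁ := hx2
  have hy2 : s₂ ≤ g y := hy2
  refine ⟨x, y, hx1.1, lt_of_le_of_ne hx1.2 ?_, hy1.2, hx2, hy2, fun t ht => ⟨?_, ?_⟩⟩
  · rintro rfl; linarith
  · by_contra! hlt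
    exact absurd (hxmax ⟨⟨hx1.1.trans ht.1.le, ht.2.le⟩, hlt.le⟩) (not_le.mpr ht.1)
  · by_contra! hlt
    exact absurd (hymin ⟨⟨hx1.1.trans ht.1.le, ht.2.le.trans hy1.2⟩, hlt.le⟩) (not_le.mpr ht.2)

/-- Once the energy is small compared with the radius, the solution stays in `(-β, β)`. -/
theorem SolvesOn.abs_lt_of_radialEnergy_small {n R β b s₁ s₂ κ : ℝ} {f u p : ℝ → ℝ} (h : H1 f b β)
    (hn : 2 ≤ n) (hu : SolvesOn n f u p (Ioi 0)) (hR : 0 < R) (hs₁ : 0 < s₁) (hs : s₁ < s₂)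
    (hsβ : s₂ < β) (hκ : 0 < κ) (hF : ∀ s ∈ Icc s₁ s₂, Fint f s ≤ -(κ ^ 2 / 2))
    (huR : |u R| < s₁)
    (hE : radialEnergy f u p R * (R + (s₁ + s₂) / κ) < n * κ * (s₂ - s₁)) {r : ℝ} (hr : R ≤ r) :
    |u r| < β := by
  by_contra! hcon
  have hpos : ∀ t, R ≤ t → 0 < t := fun t ht => hR.trans_le ht
  have hcont : ∀ S, ContinuousOn (fun t => |u t|) (Icc R S) := fun S t ht =>
    (hu t (hpos t ht.1)).1.continuousAt.abs.continuousWithinAt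
  have hA : IsCompact (Icc R r ∩ (fun t => |u t|) ⁻¹' Ici β) :=
    isCompact_Icc.of_isClosed_subset
      ((hcont r).preimage_isClosed_of_isClosed isClosed_Icc isClosed_Ici) inter_subset_left
  obtain ⟨ρ, ⟨hρ1, hρ2⟩, hρmin⟩ := hA.exists_isLeast ⟨r, ⟨hr, le_rfl⟩, hcon⟩
  have hρ2 : β ≤ |u ρ| := hρ2
  have hρ0 := hpos ρ hρ1.1
  have hlt : ∀ t ∈ Ico R ρ, |u t| ≤ β := by
    intro t ht
    by_contra! hβ
    exact absurd (hρmin ⟨⟨ht.1, ht.2.le.trans hρ1.2⟩, hβ.le⟩) (not_le.mpr ht.2)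
  have hEρ : 0 ≤ radialEnergy f u p ρ := by
    have h1 : 0 ≤ Fint f (u ρ) := by
      rw [← Fint_abs h.odd, ← h.2.2.2.2.2.2.2.2.2.1]
      exact h.strictMonoOn_Fint.monotoneOn h.b_lt.le (h.b_lt.le.trans hρ2) hρ2
    have h2 := sq_nonneg (p ρ)
    simp only [radialEnergy]
    linarith
  have hEnn : ∀ t ∈ Icc R ρ, 0 ≤ radialEnergy f u p t := fun t ht =>
    hEρ.trans (hu.antitoneOn_radialEnergy (by linarith) h.continuous (hpos t ht.1) hρ0 ht.2)
  obtain ⟨x, y, hRx, hxy, hyρ, hux, huy, hmid⟩ :=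
    exists_crossing hρ1.1 (hcont ρ) hs huR.le (hsβ.le.trans hρ2)
  have hx0 := hpos x hRx
  have hp : ∀ t ∈ Ioo x y, κ ≤ |p t| := by
    intro t ht
    have h1 := hEnn t ⟨hRx.trans ht.1.le, ht.2.le.trans hyρ⟩
    have h2 := hF _ (hmid t ht)
    simp only [Fint_abs h.odd] at h2
    simp only [radialEnergy] at h1
    exact (le_abs_self κ).trans (sq_le_sq.mp (by linarith))
  have hdiff : s₂ - s₁ ≤ |u y - u x| := by
    have := abs_sub_abs_le_abs_sub (u y) (u x)
    linarith
  have hyT : y ≤ x + (s₁ + s₂) / κ := by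
    have hcy : ∀ t ∈ Ioo x y, |u t| ≤ s₂ := fun t ht => (hmid t ht).2
    have huy' : |u y| ≤ s₂ := by
      have h1 : Tendsto (fun t => |u t|) (𝓝[<] y) (𝓝 |u y|) :=
        (hu y (hx0.trans hxy)).1.continuousAt.abs.mono_left nhdsWithin_le_nhds
      refine le_of_tendsto h1 ?_
      filter_upwards [Ioo_mem_nhdsLT hxy] with t ht using hcy t ht
    obtain ⟨ξ, hξ, hξs⟩ := exists_hasDerivAt_eq_slope u p hxy
      (fun t ht => (hu t (hx0.trans_le ht.1)).1.continuousAt.continuousWithinAt)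
      (fun t ht => (hu t (hx0.trans ht.1)).1)
    have h1 := hp ξ hξ
    have h2 : 0 < y - x := sub_pos.mpr hxy
    rw [hξs, abs_div, abs_of_pos h2, le_div_iff₀ h2] at h1
    have h3 := abs_sub (u y) (u x)
    have h4 : y - x ≤ (s₁ + s₂) / κ := by
      rw [le_div_iff₀ hκ]
      linarith
    linarith
  set T := (s₁ + s₂) / κ with hT
  have hT0 : 0 < T := div_pos (by linarith) hκ
  set K := n * κ / (x + T) with hK
  have hK0 : 0 ≤ K := by positivity
  have hanti : ∀ σ : ℝ, |σ| = 1 → radialEnergy f u p y + σ * K * u y ≤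
      radialEnergy f u p x + σ * K * u x := by
    intro σ hσ
    have hd : ∀ t, 0 < t → HasDerivAt (fun t => radialEnergy f u p t + σ * K * u t)
        (-(n / t) * p t ^ 2 + σ * K * p t) t := fun t ht =>
      (hu.hasDerivAt_radialEnergy h.continuous ht).fun_add ((hu t ht).1.const_mul (σ * K))
    have := antitoneOn_of_deriv_nonpos (f := fun t => radialEnergy f u p t + σ * K * u t)
      (convex_Icc x y)
      (fun t ht => (hd t (hx0.trans_le ht.1)).continuousAt.continuousWithinAt)
      (fun t ht => (hd t (hx0.trans_le (interior_subset ht).1)).differentiableAt.differentiableWithinAt)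
      (by
        rw [interior_Icc]
        intro t ht
        have ht0 := hx0.trans ht.1
        rw [(hd t ht0).deriv]
        have h1 := hp t ht
        have h2 : K ≤ n * κ / t := by
          rw [hK]
          exact div_le_div_of_nonneg_left (by positivity) ht0 (ht.2.le.trans hyT)
        have h3 : σ * K * p t ≤ K * |p t| := by
          refine (le_abs_self _).trans ?_
          rw [abs_mul, abs_mul, hσ, abs_of_nonneg hK0, one_mul]
        have h4 : K * |p t| ≤ n / t * |p t| ^ 2 := by
          calc K * |p t| ≤ n * κ / t * |p t| := mul_le_mul_of_nonneg_right h2 (abs_nonneg _)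
            _ = n / t * |p t| * κ := by ring
            _ ≤ n / t * |p t| * |p t| := mul_le_mul_of_nonneg_left h1 (by positivity)
            _ = n / t * |p t| ^ 2 := by ring
        rw [sq_abs] at h4
        linarith)
    exact this (left_mem_Icc.mpr hxy.le) (right_mem_Icc.mpr hxy.le) hxy.le
  have hEx : K * (s₂ - s₁) ≤ radialEnergy f u p x := by
    have hEy := hEnn y ⟨hRx.trans hxy.le, hyρ⟩
    refine (mul_le_mul_of_nonneg_left hdiff hK0).trans ?_
    rcases abs_choice (u y - u x) with h1 | h1 <;> rw [h1]
    · have := hanti 1 (by simp); linarith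
    · have := hanti (-1) (by simp); linarith
  have hsq : x ^ 2 * radialEnergy f u p x ≤ R ^ 2 * radialEnergy f u p R :=
    hu.antitoneOn_sq_mul_radialEnergy h hn hR hlt ⟨le_rfl, hRx.trans_lt (hxy.trans_le hyρ)⟩
      ⟨hRx, hxy.trans_le hyρ⟩ hRx
  have hER := hEnn R ⟨le_rfl, hρ1.1⟩
  rw [hK, div_mul_eq_mul_div, div_le_iff₀ (by positivity)] at hEx
  have h1 : x ^ 2 * (n * κ * (s₂ - s₁)) ≤ x ^ 2 * (radialEnergy f u p R * (R + T)) := by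
    calc x ^ 2 * (n * κ * (s₂ - s₁)) ≤ x ^ 2 * (radialEnergy f u p x * (x + T)) :=
          mul_le_mul_of_nonneg_left hEx (sq_nonneg x)
      _ = x ^ 2 * radialEnergy f u p x * (x + T) := by ring
      _ ≤ R ^ 2 * radialEnergy f u p R * (x + T) :=
          mul_le_mul_of_nonneg_right hsq (by positivity)
      _ = radialEnergy f u p R * (R ^ 2 * (x + T)) := by ring
      _ ≤ radialEnergy f u p R * (x ^ 2 * (R + T)) := by
          refine mul_le_mul_of_nonneg_left ?_ hER
          have h2 : 0 ≤ R * x * (x - R) := mul_nonneg (by positivity) (by linarith)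
          have h3 : 0 ≤ T * (x - R) * (x + R) :=
            mul_nonneg (mul_nonneg hT0.le (by linarith)) (by linarith)
          nlinarith
      _ = _ := by ring
  have h2 := le_of_mul_le_mul_left h1 (by positivity)
  linarith

theorem Ultrafilter.exists_tendsto_of_abs_le {ι : Type*} (𝒰 : Ultrafilter ι) {g : ι → ℝ} {B : ℝ}
    (h : ∀ᶠ a in 𝒰, |g a| ≤ B) : ∃ x, Tendsto g 𝒰 (𝓝 x) := by
  obtain ⟨x, -, hx⟩ := (isCompact_Icc (a := -B) (b := B)).ultrafilter_le_nhds (𝒰.map g)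
    (by
      rw [le_principal_iff]
      exact h.mono fun a ha => abs_le.mp ha)
  exact ⟨x, hx⟩

theorem hasDerivAt_of_tendsto_of_equicontinuous {ι : Type*} {l : Filter ι} [l.NeBot] {S : Set ι}
    (hS : ∀ᶠ a in l, a ∈ S) {g g' : ι → ℝ → ℝ} {v : ℝ → ℝ} {c r d : ℝ} (hd : 0 < d)
    (hg : ∀ a ∈ S, ∀ t ∈ Metric.ball r d, HasDerivAt (g a) (g' a t) t)
    (hv : ∀ t ∈ Metric.ball r d, Tendsto (fun a => g a t) l (𝓝 (v t)))
    (hc : Tendsto (fun a => g' a r) l (𝓝 c))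
    (heq : ∀ ε > 0, ∃ δ > 0, ∀ a ∈ S, ∀ t ∈ Metric.ball r δ, |g' a t - g' a r| ≤ ε) :
    HasDerivAt v c r := by
  rw [hasDerivAt_iff_isLittleO, Asymptotics.isLittleO_iff]
  intro ε hε
  obtain ⟨δ, hδ, hδs⟩ := heq ε hε
  filter_upwards [Metric.ball_mem_nhds r (lt_min hδ hd)] with t ht
  have hsub : ∀ s ∈ Metric.ball r (min δ d), s ∈ Metric.ball r d :=
    Metric.ball_subset_ball (min_le_right _ _)
  have hsub' : ∀ s ∈ Metric.ball r (min δ d), s ∈ Metric.ball r δ :=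
    Metric.ball_subset_ball (min_le_left _ _)
  have hr : r ∈ Metric.ball r (min δ d) := Metric.mem_ball_self (lt_min hδ hd)
  have h1 : Tendsto (fun a => ‖g a t - g a r - (t - r) • g' a r‖) l
      (𝓝 ‖v t - v r - (t - r) • c‖) :=
    (((hv t (hsub t ht)).sub (hv r (hsub r hr))).sub (hc.const_smul (t - r))).norm
  refine le_of_tendsto h1 (hS.mono fun a ha => ?_)
  have h2 := (convex_ball r (min δ d)).norm_image_sub_le_of_norm_hasDerivWithin_le
    (f := fun s => g a s - s * g' a r) (f' := fun s => g' a s - 1 * g' a r) (C := ε)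
    (fun s hs => ((hg a ha s (hsub s hs)).fun_sub
      ((hasDerivAt_id' s).mul_const (g' a r))).hasDerivWithinAt)
    (fun s hs => by
      rw [one_mul]
      exact hδs a ha s (hsub' s hs)) hr ht
  have h3 : g a t - g a r - (t - r) • g' a r = g a t - t * g' a r - (g a r - r * g' a r) := by
    rw [smul_eq_mul]
    ring
  rw [h3]
  exact h2

theorem SolvesOn.abs_deriv_le {m : ℕ} (hm : 0 < m) {f u p : ℝ → ℝ} {A M r : ℝ}
    (hodd : ∀ x, f (-x) = -f x) (hM : ∀ x ∈ Icc (-A) A, |f x| ≤ M) (hA : ∀ t, 0 < t → |u t| ≤ A)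
    (hu : SolvesOn m f u p (Ioi 0)) (hu0 : HasDerivWithinAt u 0 (Ici 0) 0) (hr : 0 < r) :
    |p r| ≤ M * r / (m + 1) := by
  simpa using hu.abs_deriv_add_le hm (c := 0) hodd hu0 hr fun t ht => by
    rw [sub_zero]
    exact hM _ (abs_le.mp (hA t ht.1))

theorem SolvesOn.abs_sub_le {m : ℕ} (hm : 0 < m) {f u p : ℝ → ℝ} {A M R s t : ℝ}
    (hodd : ∀ x, f (-x) = -f x) (hM : ∀ x ∈ Icc (-A) A, |f x| ≤ M) (hA : ∀ t, 0 < t → |u t| ≤ A)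
    (hu : SolvesOn m f u p (Ioi 0)) (hu0 : HasDerivWithinAt u 0 (Ici 0) 0)
    (hs : s ∈ Icc 0 R) (ht : t ∈ Icc 0 R) : |u t - u s| ≤ M * R * |t - s| := by
  wlog hst : s < t generalizing s t
  · rcases (not_lt.mp hst).eq_or_lt with h | h
    · simp [h]
    · rw [abs_sub_comm, abs_sub_comm t]; exact this ht hs h
  obtain ⟨ξ, hξ, hξs⟩ := exists_hasDerivAt_eq_slope u p hst
    (fun x hx => by
      rcases (hs.1.trans hx.1).eq_or_lt with h | h
      · rw [← h]
        exact hu0.continuousWithinAt.mono fun y hy => hs.1.trans hy.1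
      · exact (hu x h).1.continuousAt.continuousWithinAt)
    (fun x hx => (hu x (hs.1.trans_lt hx.1)).1)
  have h1 := hu.abs_deriv_le hm hodd hM hA hu0 (hs.1.trans_lt hξ.1)
  have h2 : 0 < t - s := sub_pos.mpr hst
  have hM0 : 0 ≤ M := (abs_nonneg _).trans (hM _ (abs_le.mp (hA 1 one_pos)))
  have hξ0 := hs.1.trans_lt hξ.1
  have h3 : M * ξ / (m + 1) ≤ M * R :=
    (div_le_self (by positivity) (by linarith [Nat.cast_nonneg (α := ℝ) m])).trans
      (mul_le_mul_of_nonneg_left (hξ.2.le.trans ht.2) hM0)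
  rw [hξs, abs_div, div_le_iff₀ (abs_pos.mpr h2.ne')] at h1
  exact h1.trans (mul_le_mul_of_nonneg_right h3 (abs_nonneg _))

theorem SolvesOn.abs_deriv_sub_le {m : ℕ} (hm : 0 < m) {f u p : ℝ → ℝ} {A M s t : ℝ}
    (hodd : ∀ x, f (-x) = -f x) (hM : ∀ x ∈ Icc (-A) A, |f x| ≤ M) (hA : ∀ t, 0 < t → |u t| ≤ A)
    (hu : SolvesOn m f u p (Ioi 0)) (hu0 : HasDerivWithinAt u 0 (Ici 0) 0)
    (hs : 0 < s) (ht : 0 < t) : |p t - p s| ≤ 2 * M * |t - s| := by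
  refine (convex_Ioi (0 : ℝ)).norm_image_sub_le_of_norm_hasDerivWithin_le
    (fun x hx => (hu x hx).2.hasDerivWithinAt) (fun x hx => ?_) hs ht
  have hx : 0 < x := hx
  have h1 := hu.abs_deriv_le hm hodd hM hA hu0 hx
  have h2 := hM _ (abs_le.mp (hA x hx))
  have hM0 : 0 ≤ M := (abs_nonneg _).trans h2
  have h3 : |(m : ℝ) / x * p x| ≤ M := by
    rw [abs_mul, abs_of_nonneg (by positivity : 0 ≤ (m : ℝ) / x)]
    calc (m : ℝ) / x * |p x| ≤ m / x * (M * x / (m + 1)) :=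
          mul_le_mul_of_nonneg_left h1 (by positivity)
      _ = M * (m / (m + 1)) := by field_simp
      _ ≤ M * 1 := mul_le_mul_of_nonneg_left (by rw [div_le_one (by positivity)]; linarith) hM0
      _ = M := mul_one M
  rw [Real.norm_eq_abs]
  have h4 := abs_sub (-(m / x) * p x) (f (u x))
  rw [neg_mul, abs_neg] at h4
  rw [neg_mul]
  linarith

/-- Bounded families of solutions are closed under pointwise limits along ultrafilters. -/
theorem exists_solvesOn_of_ultrafilter {ι : Type*} (𝒰 : Ultrafilter ι) {m : ℕ} (hm : 0 < m)
    {f : ℝ → ℝ} {U P : ι → ℝ → ℝ} {S : Set ι} {A α : ℝ} (hf : Continuous f)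
    (hodd : ∀ x, f (-x) = -f x) (hS : ∀ᶠ a in 𝒰, a ∈ S)
    (hU : ∀ a ∈ S, SolvesOn m f (U a) (P a) (Ioi 0))
    (hU0 : ∀ a ∈ S, HasDerivWithinAt (U a) 0 (Ici 0) 0) (hA : ∀ a ∈ S, ∀ t, 0 < t → |U a t| ≤ A)
    (hα : Tendsto (fun a => U a 0) 𝒰 (𝓝 α)) :
    ∃ v q : ℝ → ℝ, SolvesOn m f v q (Ioi 0) ∧ HasDerivWithinAt v 0 (Ici 0) 0 ∧ v 0 = α ∧
      ∀ r, 0 < r → Tendsto (fun a => U a r) 𝒰 (𝓝 (v r)) ∧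
        Tendsto (fun a => P a r) 𝒰 (𝓝 (q r)) := by
  obtain ⟨M, hM⟩ := (isCompact_Icc (a := -A) (b := A)).exists_bound_of_continuousOn hf.continuousOn
  simp only [Real.norm_eq_abs] at hM
  obtain ⟨a₀, ha₀⟩ := hS.exists
  have hM0 : 0 ≤ M := (abs_nonneg _).trans (hM _ (abs_le.mp (hA a₀ ha₀ 1 one_pos)))
  have hv : ∀ r, ∃ x, 0 < r → Tendsto (fun a => U a r) 𝒰 (𝓝 x) := by
    intro r
    by_cases hr : 0 < r
    · obtain ⟨x, hx⟩ := 𝒰.exists_tendsto_of_abs_le (hS.mono fun a ha => hA a ha r hr)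
      exact ⟨x, fun _ => hx⟩
    · exact ⟨0, fun h => absurd h hr⟩
  have hq : ∀ r, ∃ x, 0 < r → Tendsto (fun a => P a r) 𝒰 (𝓝 x) := by
    intro r
    by_cases hr : 0 < r
    · obtain ⟨x, hx⟩ := 𝒰.exists_tendsto_of_abs_le
        (hS.mono fun a ha => (hU a ha).abs_deriv_le hm hodd hM (hA a ha) (hU0 a ha) hr)
      exact ⟨x, fun _ => hx⟩
    · exact ⟨0, fun h => absurd h hr⟩
  choose v₀ hv₀ using hv
  choose q hq using hq
  set v := Function.update v₀ 0 α with hv_def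
  have hvt : ∀ r, 0 < r → Tendsto (fun a => U a r) 𝒰 (𝓝 (v r)) := fun r hr => by
    rw [hv_def, Function.update_of_ne hr.ne']
    exact hv₀ r hr
  have hv0 : v 0 = α := by simp [hv_def]
  have hball : ∀ {r t : ℝ}, t ∈ Metric.ball r (r / 2) → r / 2 < t ∧ t < 2 * r := by
    intro r t ht
    rw [Metric.mem_ball, Real.dist_eq, abs_lt] at ht
    constructor <;> linarith
  refine ⟨v, q, fun r hr => ⟨?_, ?_⟩, ?_, hv0, fun r hr => ⟨hvt r hr, hq r hr⟩⟩
  · have hr : 0 < r := hr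
    refine hasDerivAt_of_tendsto_of_equicontinuous (d := r / 2) hS (by positivity)
      (fun a ha t ht => (hU a ha t (by have := (hball ht).1; exact (half_pos hr).trans this)).1)
      (fun t ht => hvt t ((half_pos hr).trans (hball ht).1)) (hq r hr) ?_
    intro ε hε
    refine ⟨min (r / 2) (ε / (2 * M + 1)), by positivity, fun a ha t ht => ?_⟩
    have h1 := hball (Metric.ball_subset_ball (min_le_left _ _) ht)
    have h2 := Metric.ball_subset_ball (min_le_right _ _) ht
    rw [Metric.mem_ball, Real.dist_eq, lt_div_iff₀ (by positivity)] at h2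
    have h3 := (hU a ha).abs_deriv_sub_le hm hodd hM (hA a ha) (hU0 a ha) hr
      ((half_pos hr).trans h1.1)
    nlinarith [abs_nonneg (t - r)]
  · have hr : 0 < r := hr
    refine hasDerivAt_of_tendsto_of_equicontinuous (d := r / 2) hS (by positivity)
      (fun a ha t ht => (hU a ha t (by have := (hball ht).1; exact (half_pos hr).trans this)).2)
      (fun t ht => hq t ((half_pos hr).trans (hball ht).1))
      (((hq r hr).const_mul _).sub ((hf.tendsto _).comp (hvt r hr))) ?_
    intro ε hε
    have huc := (isCompact_Icc (a := -A) (b := A)).uniformContinuousOn_of_continuous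
      hf.continuousOn
    obtain ⟨η, hη, hηs⟩ := Metric.uniformContinuousOn_iff.mp huc (ε / 2) (by positivity)
    set L := 3 * M * m / r + 1 with hL
    set L' := M * (2 * r) + 1 with hL'
    have hL0 : 0 < L := by positivity
    have hL0' : 0 < L' := by positivity
    refine ⟨min (r / 2) (min (ε / (2 * L)) (η / L')), by positivity, fun a ha t ht => ?_⟩
    have h1 := hball (Metric.ball_subset_ball (min_le_left _ _) ht)
    have h2 := Metric.ball_subset_ball ((min_le_right _ _).trans (min_le_left _ _)) ht
    have h3 := Metric.ball_subset_ball ((min_le_right _ _).trans (min_le_right _ _)) ht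
    rw [Metric.mem_ball, Real.dist_eq, lt_div_iff₀ (by positivity)] at h2 h3
    have ht0 : 0 < t := (half_pos hr).trans h1.1
    have hP := (hU a ha).abs_deriv_sub_le hm hodd hM (hA a ha) (hU0 a ha) hr ht0
    have hPt := (hU a ha).abs_deriv_le hm hodd hM (hA a ha) (hU0 a ha) ht0
    have hUt := (hU a ha).abs_sub_le (R := 2 * r) hm hodd hM (hA a ha) (hU0 a ha)
      (s := r) (t := t) ⟨hr.le, by linarith⟩ ⟨ht0.le, h1.2.le⟩
    have hfU : |f (U a t) - f (U a r)| ≤ ε / 2 := by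
      refine (hηs _ (abs_le.mp (hA a ha t ht0)) _ (abs_le.mp (hA a ha r hr)) ?_).le
      rw [Real.dist_eq]
      have := abs_nonneg (t - r)
      nlinarith
    have hPt' : |P a t| ≤ M * t :=
      hPt.trans (div_le_self (by positivity) (by linarith [Nat.cast_nonneg (α := ℝ) m]))
    have hx1 : |(m : ℝ) * (t - r) / (t * r) * P a t| ≤ M * m / r * |t - r| := by
      rw [abs_mul, abs_div, abs_mul, abs_of_pos (mul_pos ht0 hr), Nat.abs_cast]
      calc (m : ℝ) * |t - r| / (t * r) * |P a t| ≤ m * |t - r| / (t * r) * (M * t) :=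
            mul_le_mul_of_nonneg_left hPt' (by positivity)
        _ = M * m / r * |t - r| := by field_simp
    have hx2 : |(m : ℝ) / r * (P a t - P a r)| ≤ 2 * M * m / r * |t - r| := by
      rw [abs_mul, abs_of_nonneg (by positivity : 0 ≤ (m : ℝ) / r)]
      calc (m : ℝ) / r * |P a t - P a r| ≤ m / r * (2 * M * |t - r|) :=
            mul_le_mul_of_nonneg_left hP (by positivity)
        _ = 2 * M * m / r * |t - r| := by ring
    have hsplit : -((m : ℝ) / t) * P a t - f (U a t) - (-(m / r) * P a r - f (U a r)) =
        m * (t - r) / (t * r) * P a t - m / r * (P a t - P a r) - (f (U a t) - f (U a r)) := by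
      field_simp
      ring
    rw [hsplit]
    have hL2 : M * m / r * |t - r| + 2 * M * m / r * |t - r| ≤ |t - r| * L := by
      have : M * m / r * |t - r| + 2 * M * m / r * |t - r| = |t - r| * (3 * M * m / r) := by ring
      rw [this]
      exact mul_le_mul_of_nonneg_left (by rw [hL]; linarith) (abs_nonneg _)
    have hy1 := abs_sub (m * (t - r) / (t * r) * P a t - m / r * (P a t - P a r))
      (f (U a t) - f (U a r))
    have hy2 := abs_sub (m * (t - r) / (t * r) * P a t) (m / r * (P a t - P a r))
    linarith
  · rw [hasDerivWithinAt_iff_isLittleO, Asymptotics.isLittleO_iff]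
    intro ε hε
    have hev : ∀ᶠ r in 𝓝[Ici 0] (0 : ℝ), r < ε / (M + 1) :=
      nhdsWithin_le_nhds (Iio_mem_nhds (by positivity))
    filter_upwards [hev, self_mem_nhdsWithin] with r hr1 hr
    have hr : 0 ≤ r := hr
    rcases hr.eq_or_lt with h | h
    · simp [← h]
    have h1 : Tendsto (fun a => |U a r - U a 0|) 𝒰 (𝓝 |v r - v 0|) := by
      rw [hv0]
      exact ((hvt r h).sub hα).abs
    rw [smul_zero, sub_zero, sub_zero, Real.norm_eq_abs, Real.norm_eq_abs]
    refine le_of_tendsto h1 (hS.mono fun a ha => ?_)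
    have h2 := (hU a ha).abs_sub_le (R := r) hm hodd hM (hA a ha) (hU0 a ha)
      (s := 0) (t := r) ⟨le_rfl, hr⟩ ⟨hr, le_rfl⟩
    rw [sub_zero] at h2
    refine h2.trans (mul_le_mul_of_nonneg_right ?_ (abs_nonneg _))
    rw [lt_div_iff₀ (by positivity)] at hr1
    nlinarith

theorem SolvesOn.radialEnergy_nonneg {n r : ℝ} {f u p : ℝ → ℝ} (hn : 0 ≤ n) (hf : Continuous f)
    (hu : SolvesOn n f u p (Ioi 0)) (hlim : Tendsto u atTop (𝓝 0)) (hr : 0 < r) :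
    0 ≤ radialEnergy f u p r := by
  have h1 : Tendsto (fun s => Fint f (u s)) atTop (𝓝 0) := by
    have := ((continuous_Fint hf).tendsto 0).comp hlim
    rwa [Fint_zero] at this
  refine le_of_tendsto h1 ?_
  filter_upwards [eventually_ge_atTop r] with s hs
  have h2 := hu.antitoneOn_radialEnergy hn hf hr (hr.trans_le hs) hs
  have h3 := sq_nonneg (p s)
  simp only [radialEnergy] at h2 ⊢
  linarith

theorem H1.eq_zero_of_radialEnergy_nonneg {f u p : ℝ → ℝ} {b β r : ℝ} (h : H1 f b β)
    (hE : 0 ≤ radialEnergy f u p r) (hp : p r = 0) (hf : f (u r) = 0) : u r = 0 := by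
  simp only [radialEnergy, hp] at hE
  rcases h.eq_zero_or_le_abs (s := u r) (by linarith) with h1 | h1
  · exact h1
  · exact absurd hf (h.apply_ne_zero (h.b_lt.trans_le h1))

theorem SolvesOn.le_abs_zero {m : ℕ} (hm : 0 < m) {f u p : ℝ → ℝ} {b β : ℝ} (h : H1 f b β)
    (hu : SolvesOn m f u p (Ioi 0)) (hu0 : HasDerivWithinAt u 0 (Ici 0) 0)
    (hlim : Tendsto u atTop (𝓝 0)) (hnc : ∃ x ∈ Ici (0 : ℝ), ∃ y ∈ Ici (0 : ℝ), u x ≠ u y) :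
    β ≤ |u 0| := by
  have hnn : ∀ r, 0 < r → 0 ≤ radialEnergy f u p r := fun r hr =>
    hu.radialEnergy_nonneg (Nat.cast_nonneg m) h.continuous hlim hr
  have hle : ∀ r, 0 < r → radialEnergy f u p r ≤ Fint f (u 0) := fun r hr =>
    hu.radialEnergy_le hm h.continuous h.odd hu0 hr
  refine (h.eq_zero_or_le_abs ((hnn 1 one_pos).trans (hle 1 one_pos))).resolve_left fun h0 => ?_
  rw [h0, Fint_zero] at hle
  have hp : ∀ r, 0 < r → p r = 0 := by
    intro r hr
    have h1 : radialEnergy f u p =ᶠ[𝓝 r] fun _ => 0 := by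
      filter_upwards [Ioi_mem_nhds hr] with t ht using le_antisymm (hle t ht) (hnn t ht)
    have h2 := ((hasDerivAt_const r (0 : ℝ)).congr_of_eventuallyEq h1).unique
      (hu.hasDerivAt_radialEnergy h.continuous hr)
    have h3 : (0 : ℝ) < m / r := by positivity
    rw [neg_mul, eq_comm, neg_eq_zero, mul_eq_zero, or_iff_right h3.ne'] at h2
    exact pow_eq_zero_iff two_ne_zero |>.mp h2
  have hconst : ∀ x ∈ Ici (0 : ℝ), u x = 0 := by
    intro x hx
    rcases (show 0 ≤ x from hx).eq_or_lt with h1 | h1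
    · rw [← h1, h0]
    obtain ⟨ξ, hξ, hξs⟩ := exists_hasDerivAt_eq_slope u p h1
      (fun t ht => by
        rcases ht.1.eq_or_lt with h2 | h2
        · rw [← h2]; exact hu0.continuousWithinAt.mono Icc_subset_Ici_self
        · exact (hu t h2).1.continuousAt.continuousWithinAt)
      (fun t ht => (hu t ht.1).1)
    rw [hp ξ hξ.1, h0, sub_zero, sub_zero, eq_comm, div_eq_zero_iff] at hξs
    exact hξs.resolve_right h1.ne'
  obtain ⟨x, hx, y, hy, hxy⟩ := hnc
  exact hxy (by rw [hconst x hx, hconst y hy])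

theorem SolvesOn.exists_radius {n b β s₁ T c : ℝ} {f u p : ℝ → ℝ} (h : H1 f b β) (hn : 2 ≤ n)
    (hu : SolvesOn n f u p (Ioi 0)) (hu0 : ContinuousWithinAt u (Ici 0) 0) (h0 : u 0 ≠ 0)
    (hlim : Tendsto u atTop (𝓝 0)) (hs₁ : 0 < s₁) (hs₁β : s₁ < β) (hT : 0 < T) (hc : 0 < c) :
    ∃ R, 0 < R ∧ (∀ r ∈ Ioc 0 R, u r = 0 → p r ≠ 0) ∧ |u R| < s₁ ∧
      radialEnergy f u p R * (R + T) < c := by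
  by_cases hZ : ∃ r, 0 < r ∧ u r = 0 ∧ p r = 0
  · obtain ⟨r₀, hr₀, hur₀, hpr₀⟩ := hZ
    have h1 : ∀ᶠ r in 𝓝[>] (0 : ℝ), u r ≠ 0 :=
      (hu0.mono_left (nhdsWithin_mono _ Ioi_subset_Ici_self)).eventually_ne h0
    obtain ⟨d, hd, hds⟩ := (mem_nhdsGT_iff_exists_Ioo_subset).mp h1
    have hd : 0 < d := hd
    have hge : ∀ r, 0 < r → u r = 0 → d ≤ r := by
      intro r hr hur
      by_contra! hlt
      exact hds ⟨hr, hlt⟩ hur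
    have hcu : ContinuousOn (fun r => (u r, p r)) (Icc d r₀) := fun r hr =>
      ((hu r (hd.trans_le hr.1)).1.continuousAt.prodMk
        (hu r (hd.trans_le hr.1)).2.continuousAt).continuousWithinAt
    have hK : IsCompact (Icc d r₀ ∩ (fun r => (u r, p r)) ⁻¹' {(0, 0)}) :=
      isCompact_Icc.of_isClosed_subset
        (hcu.preimage_isClosed_of_isClosed isClosed_Icc isClosed_singleton) inter_subset_left
    obtain ⟨D, ⟨hD1, hD2⟩, hDmin⟩ := hK.exists_isLeast
      ⟨r₀, ⟨hge r₀ hr₀ hur₀, le_rfl⟩, by simp [hur₀, hpr₀]⟩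
    simp only [mem_preimage, mem_singleton_iff, Prod.mk.injEq] at hD2
    have hD0 : 0 < D := hd.trans_le hD1.1
    have hED : radialEnergy f u p D = 0 := by simp [radialEnergy, hD2.1, hD2.2, Fint_zero]
    have h2 : ∀ᶠ r in 𝓝 D, |u r| < s₁ := by
      have := (hu D hD0).1.continuousAt.abs.tendsto
      rw [hD2.1, abs_zero] at this
      exact this.eventually_lt_const hs₁
    have h3 : ∀ᶠ r in 𝓝 D, radialEnergy f u p r * (r + T) < c := by
      have h4 : ContinuousAt (fun r => radialEnergy f u p r * (r + T)) D :=
        (hu.hasDerivAt_radialEnergy h.continuous hD0).continuousAt.mul (by fun_prop)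
      have h5 := h4.tendsto
      rw [hED, zero_mul] at h5
      exact h5.eventually_lt_const hc
    have h6 : ∀ᶠ r in 𝓝[<] D, (|u r| < s₁ ∧ radialEnergy f u p r * (r + T) < c) ∧ r ∈ Ioo 0 D :=
      ((h2.and h3).filter_mono nhdsWithin_le_nhds).and (Ioo_mem_nhdsLT hD0)
    obtain ⟨R, ⟨hR1, hR2⟩, hR3⟩ := h6.exists
    refine ⟨R, hR3.1, fun r hr hur hpr => ?_, hR1, hR2⟩
    have hrD : r < D := hr.2.trans_lt hR3.2
    exact absurd (hDmin ⟨⟨hge r hr.1 hur, hrD.le.trans hD1.2⟩, by simp [hur, hpr]⟩)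
      (not_le.mpr hrD)
  · push Not at hZ
    have h1 : ∀ᶠ r in atTop, |u r| < s₁ := by
      have := hlim.abs
      rw [abs_zero] at this
      exact this.eventually_lt_const hs₁
    obtain ⟨R₀, hR₀⟩ := (h1.and (eventually_gt_atTop 0)).exists_forall_of_atTop
    have hR₀0 : 0 < R₀ := (hR₀ R₀ le_rfl).2
    have hEnn := hu.radialEnergy_nonneg (by linarith) h.continuous hlim hR₀0
    set C := R₀ ^ 2 * radialEnergy f u p R₀ with hC
    have hC0 : 0 ≤ C := by positivity
    set R := R₀ + T + 2 * C / c with hR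
    have hR0 : 0 < R := by positivity
    have hC2 : 0 ≤ 2 * C / c := by positivity
    have hle : R₀ ≤ R := by rw [hR]; linarith
    refine ⟨R, hR0, fun r hr hur => hZ r hr.1 hur, (hR₀ R hle).1, ?_⟩
    have h2 : R ^ 2 * radialEnergy f u p R ≤ C :=
      hu.antitoneOn_sq_mul_radialEnergy (S := R + 1) h hn hR₀0
        (fun r hr => ((hR₀ r hr.1).1.trans hs₁β).le) ⟨le_rfl, by linarith⟩ ⟨hle, by linarith⟩ hle
    have hER := hu.radialEnergy_nonneg (by linarith) h.continuous hlim hR0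
    have h3 : radialEnergy f u p R * (R + T) ≤ radialEnergy f u p R * (2 * R) :=
      mul_le_mul_of_nonneg_left (by rw [hR]; linarith) hER
    have h4 : 2 * C < c * R := by
      have : 2 * C / c < R := by rw [hR]; linarith
      rwa [div_lt_iff₀ hc, mul_comm R] at this
    refine lt_of_mul_lt_mul_left ?_ hR0.le
    nlinarith

theorem ChangesSignExactly.exists_eq_of_transversal {u p : ℝ → ℝ} {y : ℕ → ℝ} {m : ℕ} {r : ℝ}
    (hy0 : y 0 = 0) (hstr : ∀ i < m, ∀ r, y i < r → r < y (i + 1) → 0 < (-1 : ℝ) ^ i * u r)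
    (hlast : ∀ r, y m < r → 0 ≤ (-1 : ℝ) ^ m * u r)
    (hr : 0 < r) (hu : HasDerivAt u (p r) r) (hur : u r = 0) (hpr : p r ≠ 0) :
    ∃ i ∈ Finset.Icc 1 m, r = y i := by
  by_contra! hcon
  have h1 : ∀ j ≤ m, y j < r := by
    intro j
    induction j with
    | zero => intro; rwa [hy0]
    | succ j ih =>
      intro hj
      by_contra! hle
      have h2 := hcon (j + 1) (Finset.mem_Icc.mpr ⟨by omega, hj⟩)
      have h3 := hstr j (by omega) r (ih (by omega)) (lt_of_le_of_ne hle h2)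
      rw [hur, mul_zero] at h3
      exact lt_irrefl _ h3
  have h2 : IsLocalMin (fun t => (-1 : ℝ) ^ m * u t) r := by
    filter_upwards [Ioi_mem_nhds (h1 m le_rfl)] with t ht
    rw [hur, mul_zero]
    exact hlast t ht
  have h3 := h2.hasDerivAt_eq_zero (hu.const_mul ((-1 : ℝ) ^ m))
  rw [mul_eq_zero] at h3
  exact h3.elim (pow_ne_zero m (by norm_num)) hpr

theorem ChangesSignExactly.exists_ne_eq_of_transversal {u p : ℝ → ℝ} {m : ℕ} {ζ : ℕ → ℝ}
    (h : ChangesSignExactly u m)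
    (hζ : ∀ i < m + 1, 0 < ζ i ∧ HasDerivAt u (p (ζ i)) (ζ i) ∧ u (ζ i) = 0 ∧ p (ζ i) ≠ 0) :
    ∃ i < m + 1, ∃ j < m + 1, i ≠ j ∧ ζ i = ζ j := by
  obtain ⟨y, hy0, -, -, hstr, hlast⟩ := h
  have h1 : ∀ i, ∃ j, i < m + 1 → j ∈ Finset.Icc 1 m ∧ ζ i = y j := by
    intro i
    by_cases hi : i < m + 1
    · obtain ⟨h2, h3, h4, h5⟩ := hζ i hi
      obtain ⟨j, hj⟩ := ChangesSignExactly.exists_eq_of_transversal hy0 hstr hlast h2 h3 h4 h5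
      exact ⟨j, fun _ => hj⟩
    · exact ⟨0, fun h => absurd h hi⟩
  choose g hg using h1
  obtain ⟨i, hi, j, hj, hij, hgij⟩ := Finset.exists_ne_map_eq_of_card_lt_of_maps_to
    (s := Finset.range (m + 1)) (t := Finset.Icc 1 m) (f := g) (by simp)
    (fun i hi => (hg i (Finset.mem_range.mp hi)).1)
  rw [Finset.mem_range] at hi hj
  exact ⟨i, hi, j, hj, hij, by rw [(hg i hi).2, (hg j hj).2, hgij]⟩

/-- Continuous dependence on the initial value at a solution without equilibrium points. -/
theorem SolvesOn.tendsto_ultrafilter {ι : Type*} (𝒰 : Ultrafilter ι) {m : ℕ} (hm : 0 < m)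
    {f u p : ℝ → ℝ} {U P : ι → ℝ → ℝ} {S : Set ι} {A R : ℝ} (hf : Continuous f)
    (hodd : ∀ x, f (-x) = -f x) (hu : SolvesOn m f u p (Ioi 0))
    (hu0 : HasDerivWithinAt u 0 (Ici 0) 0) (hne : f (u 0) ≠ 0)
    (hR : ∀ r ∈ Ioc 0 R, p r ≠ 0 ∨ f (u r) ≠ 0) (hS : ∀ᶠ a in 𝒰, a ∈ S)
    (hU : ∀ a ∈ S, SolvesOn m f (U a) (P a) (Ioi 0))
    (hU0 : ∀ a ∈ S, HasDerivWithinAt (U a) 0 (Ici 0) 0) (hA : ∀ a ∈ S, ∀ t, 0 < t → |U a t| ≤ A)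
    (hα : Tendsto (fun a => U a 0) 𝒰 (𝓝 (u 0))) {r : ℝ} (hr : r ∈ Ioc 0 R) :
    Tendsto (fun a => U a r) 𝒰 (𝓝 (u r)) ∧ Tendsto (fun a => P a r) 𝒰 (𝓝 (p r)) := by
  obtain ⟨v, q, hv, hv0, hv0', hlim⟩ := exists_solvesOn_of_ultrafilter 𝒰 hm hf hodd hS hU hU0 hA hα
  have h1 := SolvesOn.unique (Nat.cast_nonneg m) hf hodd hu hv hu0.continuousWithinAt
    hv0.continuousWithinAt hv0'.symm (hu.tendsto_deriv_div hm hf hodd hu0)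
    (hv.tendsto_deriv_div hm hf hodd hv0) hne hR r hr
  rw [h1.1, h1.2]
  exact hlim r hr.1

theorem lt_of_forall_lt_succ {ζ : ℕ → ℝ} {k : ℕ} (h : ∀ i, i + 1 < k → ζ i < ζ (i + 1)) :
    ∀ i < k, ∀ j < i, ζ j < ζ i := by
  intro i
  induction i with
  | zero => intro _ j hj; omega
  | succ i ih =>
    intro hi j hj
    rcases (Nat.lt_succ_iff.mp hj).eq_or_lt with h1 | h1
    · rw [h1]; exact h i hi
    · exact (ih (by omega) j h1).trans (h i hi)

/-- A limit of solutions with `m + 1` transversal zeros in a bounded interval on which the limit has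
no double zero does not change sign exactly `m` times. -/
theorem SolvesOn.not_changesSignExactly {ι : Type*} (𝒰 : Ultrafilter ι) {m k : ℕ} (hm : 0 < m)
    {f u p : ℝ → ℝ} {U P : ι → ℝ → ℝ} {S : Set ι} {A R : ℝ} {z : ι → ℕ → ℝ} (hf : Continuous f)
    (hodd : ∀ x, f (-x) = -f x) (hu : SolvesOn m f u p (Ioi 0))
    (hu0 : HasDerivWithinAt u 0 (Ici 0) 0) (h0 : u 0 ≠ 0) (hne : f (u 0) ≠ 0)
    (hR : ∀ r ∈ Ioc 0 R, p r ≠ 0 ∨ f (u r) ≠ 0) (hdz : ∀ r ∈ Ioc 0 R, u r = 0 → p r ≠ 0)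
    (hS : ∀ᶠ a in 𝒰, a ∈ S)
    (hU : ∀ a ∈ S, SolvesOn m f (U a) (P a) (Ioi 0))
    (hU0 : ∀ a ∈ S, HasDerivWithinAt (U a) 0 (Ici 0) 0) (hA : ∀ a ∈ S, ∀ t, 0 < t → |U a t| ≤ A)
    (hα : Tendsto (fun a => U a 0) 𝒰 (𝓝 (u 0)))
    (hz : ∀ᶠ a in 𝒰, (∀ i, i + 1 < k + 1 → z a i < z a (i + 1)) ∧
      ∀ i < k + 1, z a i ∈ Ioc 0 R ∧ U a (z a i) = 0 ∧ (-1 : ℝ) ^ i * P a (z a i) < 0) :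
    ¬ ChangesSignExactly u k := by
  obtain ⟨M, hM⟩ := (isCompact_Icc (a := -A) (b := A)).exists_bound_of_continuousOn hf.continuousOn
  simp only [Real.norm_eq_abs] at hM
  have hlim := fun r (hr : r ∈ Ioc 0 R) =>
    SolvesOn.tendsto_ultrafilter 𝒰 hm hf hodd hu hu0 hne hR hS hU hU0 hA hα hr
  have hex : ∀ i, ∃ x, i < k + 1 → Tendsto (fun a => z a i) 𝒰 (𝓝 x) := by
    intro i
    by_cases hi : i < k + 1
    · obtain ⟨x, hx⟩ := 𝒰.exists_tendsto_of_abs_le (g := fun a => z a i) (B := R)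
        (hz.mono fun a ha => by
          have := (ha.2 i hi).1
          rw [abs_of_pos this.1]
          exact this.2)
      exact ⟨x, fun _ => hx⟩
    · exact ⟨0, fun h => absurd h hi⟩
  choose ζ hζ using hex
  have hmem : ∀ i < k + 1, ζ i ∈ Icc 0 R := fun i hi =>
    isClosed_Icc.mem_of_tendsto (hζ i hi) (hz.mono fun a ha => Ioc_subset_Icc_self (ha.2 i hi).1)
  have huζ : ∀ i < k + 1, u (ζ i) = 0 := by
    intro i hi
    have h1 : Tendsto (fun a => |U a (ζ i)|) 𝒰 (𝓝 |u (ζ i)|) := by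
      rcases (hmem i hi).1.eq_or_lt with h2 | h2
      · rw [← h2]; exact hα.abs
      · exact (hlim _ ⟨h2, (hmem i hi).2⟩).1.abs
    have h2 : Tendsto (fun a => M * R * |ζ i - z a i|) 𝒰 (𝓝 (M * R * |ζ i - ζ i|)) :=
      ((hζ i hi).const_sub (ζ i)).abs.const_mul _
    rw [sub_self, abs_zero, mul_zero] at h2
    have h3 : |u (ζ i)| ≤ 0 := by
      refine le_of_tendsto_of_tendsto h1 h2 ?_
      filter_upwards [hz, hS] with a ha haS
      have h4 := (hU a haS).abs_sub_le hm hodd hM (hA a haS) (hU0 a haS)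
        (Ioc_subset_Icc_self (ha.2 i hi).1) (hmem i hi)
      rwa [(ha.2 i hi).2.1, sub_zero] at h4
    exact abs_nonpos_iff.mp h3
  have hpos : ∀ i < k + 1, ζ i ∈ Ioc 0 R := by
    intro i hi
    refine ⟨lt_of_le_of_ne (hmem i hi).1 fun h1 => h0 ?_, (hmem i hi).2⟩
    exact (congrArg u h1).trans (huζ i hi)
  have hpζ : ∀ i < k + 1, (-1 : ℝ) ^ i * p (ζ i) < 0 := by
    intro i hi
    have h1 := (hlim _ (hpos i hi)).2
    have h2 : Tendsto (fun a => 2 * M * |z a i - ζ i|) 𝒰 (𝓝 (2 * M * |ζ i - ζ i|)) :=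
      ((hζ i hi).sub_const (ζ i)).abs.const_mul _
    rw [sub_self, abs_zero, mul_zero] at h2
    have h3 : Tendsto (fun a => P a (z a i) - P a (ζ i)) 𝒰 (𝓝 0) := by
      refine squeeze_zero_norm' ?_ h2
      filter_upwards [hz, hS] with a ha haS
      exact (hU a haS).abs_deriv_sub_le hm hodd hM (hA a haS) (hU0 a haS) (hpos i hi).1
        (ha.2 i hi).1.1
    have h4 : Tendsto (fun a => (-1 : ℝ) ^ i * P a (z a i)) 𝒰 (𝓝 ((-1) ^ i * p (ζ i))) := by
      have := (h3.add h1).const_mul ((-1 : ℝ) ^ i)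
      simpa using this
    refine lt_of_le_of_ne (le_of_tendsto h4 (hz.mono fun a ha => (ha.2 i hi).2.2.le)) ?_
    exact mul_ne_zero (pow_ne_zero _ (by norm_num)) (hdz _ (hpos i hi) (huζ i hi))
  have hmono : ∀ i, i + 1 < k + 1 → ζ i < ζ (i + 1) := by
    intro i hi
    refine lt_of_le_of_ne (le_of_tendsto_of_tendsto (hζ i (by omega)) (hζ (i + 1) hi)
      (hz.mono fun a ha => (ha.1 i hi).le)) fun h1 => ?_
    have h2 := hpζ i (by omega)
    have h3 := hpζ (i + 1) hi
    rw [← h1, pow_succ] at h3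
    linarith
  intro hsign
  obtain ⟨i, hi, j, hj, hij, hζij⟩ := hsign.exists_ne_eq_of_transversal (p := p) fun i hi =>
    ⟨(hpos i hi).1, (hu _ (hpos i hi).1).1, huζ i hi, hdz _ (hpos i hi) (huζ i hi)⟩
  rcases lt_or_gt_of_ne hij with h1 | h1
  · exact (lt_of_forall_lt_succ hmono j hj i h1).ne hζij
  · exact (lt_of_forall_lt_succ hmono i hi j h1).ne' hζij

theorem H1.exists_barrier {f : ℝ → ℝ} {b β : ℝ} (h : H1 f b β) :
    ∃ s₁ s₂ κ, 0 < s₁ ∧ s₁ < s₂ ∧ s₂ < β ∧ 0 < κ ∧ ∀ s ∈ Icc s₁ s₂, Fint f s ≤ -(κ ^ 2 / 2) := by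
  have hβ : 0 < β := h.b_pos.trans h.b_lt
  obtain ⟨x, hx, hxmax⟩ := (isCompact_Icc (a := β / 3) (b := 2 * β / 3)).exists_isMaxOn
    ⟨β / 3, le_rfl, by linarith⟩ (continuous_Fint h.continuous).continuousOn
  have h1 : Fint f x < 0 := h.Fint_neg_of_mem (by linarith [hx.1]) (by linarith [hx.2])
  refine ⟨β / 3, 2 * β / 3, Real.sqrt (-(2 * Fint f x)), by linarith, by linarith, by linarith,
    Real.sqrt_pos.mpr (by linarith), fun s hs => ?_⟩
  rw [Real.sq_sqrt (by linarith)]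
  have h2 : Fint f s ≤ Fint f x := hxmax hs
  linarith

/-- Lemma 3.4: near a `k`-th bound state, solutions that still have `k`
transversal zeros stay in `(-β, β)` after the last of them. -/
theorem stmt_8 (N : ℕ) (hN : 2 < N) (f : ℝ → ℝ) (b β : ℝ) (hH1 : H1 f b β)
    (k : ℕ) (hk : 1 ≤ k)
    (U : ℝ → ℝ → ℝ)
    (hU : ∀ α : ℝ, IsRadialSol N f (U α) ∧ U α 0 = α)
    (αstar : ℝ)
    (hnc : ∃ x ∈ Ici (0:ℝ), ∃ y ∈ Ici (0:ℝ), U αstar x ≠ U αstar y)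
    (hlim : Tendsto (U αstar) atTop (𝓝 0))
    (hsign : ChangesSignExactly (U αstar) (k - 1)) :
    ∃ ε > (0:ℝ), ∀ ᾱ ∈ Icc (αstar - ε) (αstar + ε),
      ∀ z : ℕ → ℝ, 0 < z 0 →
        (∀ i, i + 1 < k → z i < z (i + 1)) →
        (∀ i < k, U ᾱ (z i) = 0 ∧ (-1 : ℝ) ^ i * deriv (U ᾱ) (z i) < 0) →
        (∀ r, 0 < r → r < z 0 → 0 < U ᾱ r) →
        (∀ i, i + 1 < k → ∀ r, z i < r → r < z (i + 1) →
          0 < (-1 : ℝ) ^ (i + 1) * U ᾱ r) →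
        ∀ r, z (k - 1) < r → |U ᾱ r| < β := by
  obtain ⟨m, rfl⟩ : ∃ m, N = m + 1 := ⟨N - 1, by omega⟩
  obtain ⟨k, rfl⟩ : ∃ j, k = j + 1 := ⟨k - 1, by omega⟩
  simp only [Nat.add_sub_cancel] at hsign ⊢
  have hm : 0 < m := by omega
  have hm2 : (2 : ℝ) ≤ m := by exact_mod_cast (by omega : 2 ≤ m)
  have hf := hH1.continuous
  have hsol : ∀ a, SolvesOn m f (U a) (deriv (U a)) (Ioi 0) := by
    intro a
    have := (hU a).1.solvesOn
    rwa [Nat.cast_add, Nat.cast_one, add_sub_cancel_right] at this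
  have hsol0 : ∀ a, HasDerivWithinAt (U a) 0 (Ici 0) 0 := fun a => (hU a).1.2.1
  have hβα := (hsol αstar).le_abs_zero hm hH1 (hsol0 αstar) hlim hnc
  have hbα := hH1.b_lt.trans_le hβα
  have h0 : U αstar 0 ≠ 0 := abs_pos.mp (hH1.b_pos.trans hbα)
  obtain ⟨s₁, s₂, κ, hs₁, hs, hsβ, hκ, hF⟩ := hH1.exists_barrier
  obtain ⟨R, hR, hdz, huR, hER⟩ := (hsol αstar).exists_radius (T := (s₁ + s₂) / κ)
    (c := m * κ * (s₂ - s₁)) hH1 hm2 (hsol0 αstar).continuousWithinAt h0 hlim hs₁ (hs.trans hsβ)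
    (div_pos (by linarith) hκ) (mul_pos (by positivity) (by linarith))
  have hequi : ∀ r ∈ Ioc 0 R, deriv (U αstar) r ≠ 0 ∨ f (U αstar r) ≠ 0 := by
    intro r hr
    by_contra! hcon
    exact hdz r hr (hH1.eq_zero_of_radialEnergy_nonneg
      ((hsol αstar).radialEnergy_nonneg (Nat.cast_nonneg m) hf hlim hr.1) hcon.1 hcon.2) hcon.1
  by_contra! hcon
  set B : Set ℝ := {a | ∃ z : ℕ → ℝ, ∃ r, (0 < z 0 ∧ (∀ i, i + 1 < k + 1 → z i < z (i + 1)) ∧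
    ∀ i < k + 1, U a (z i) = 0 ∧ (-1 : ℝ) ^ i * deriv (U a) (z i) < 0) ∧
    z k < r ∧ β ≤ |U a r|} with hB
  have hfreq : ∃ᶠ a in 𝓝 αstar, a ∈ B := by
    rw [Metric.nhds_basis_closedBall.frequently_iff]
    intro ε hε
    obtain ⟨a, ha, z, hz0, hz1, hz2, -, -, r, hr, hβr⟩ := hcon ε hε
    exact ⟨a, by rwa [Real.closedBall_eq_Icc], z, r, ⟨hz0, hz1, hz2⟩, hr, hβr⟩
  have : (𝓝 αstar ⊓ 𝓟 B).NeBot := frequently_mem_iff_neBot.mp hfreq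
  obtain ⟨𝒰, h𝒰⟩ := Ultrafilter.exists_le (𝓝 αstar ⊓ 𝓟 B)
  have h𝒰α : Tendsto (fun a => U a 0) 𝒰 (𝓝 (U αstar 0)) := by
    simp only [fun a => (hU a).2]
    exact h𝒰.trans inf_le_left
  have h𝒰B : ∀ᶠ a in 𝒰, a ∈ B := le_principal_iff.mp (h𝒰.trans inf_le_right)
  have hS : ∀ᶠ a in 𝒰, a ∈ {a | b ≤ |U a 0| ∧ |U a 0| ≤ |U αstar 0| + 1} :=
    (h𝒰α.abs.eventually_const_le hbα).and (h𝒰α.abs.eventually_le_const (by linarith))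
  have hA : ∀ a ∈ {a | b ≤ |U a 0| ∧ |U a 0| ≤ |U αstar 0| + 1}, ∀ t, 0 < t →
      |U a t| ≤ |U αstar 0| + 1 := fun a ha t ht =>
    ((hsol a).abs_le_abs_zero hm hH1 (hsol0 a) ha.1 ht).trans ha.2
  have hne := hH1.apply_ne_zero hbα
  obtain ⟨hUR, hPR⟩ := SolvesOn.tendsto_ultrafilter 𝒰 hm hf hH1.odd (hsol αstar) (hsol0 αstar) hne
    hequi hS (fun a _ => hsol a) (fun a _ => hsol0 a) hA h𝒰α (right_mem_Ioc.mpr hR)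
  have htrap : ∀ᶠ a in 𝒰, ∀ r, R ≤ r → |U a r| < β := by
    have hE : Tendsto (fun a => radialEnergy f (U a) (deriv (U a)) R * (R + (s₁ + s₂) / κ)) 𝒰
        (𝓝 (radialEnergy f (U αstar) (deriv (U αstar)) R * (R + (s₁ + s₂) / κ))) :=
      (((hPR.pow 2).div_const 2).add (((continuous_Fint hf).tendsto _).comp hUR)).mul_const _
    filter_upwards [hUR.abs.eventually_lt_const huR, hE.eventually_lt_const hER] with a h1 h2 r hr
    exact (hsol a).abs_lt_of_radialEnergy_small hH1 hm2 hR hs₁ hs hsβ hκ hF h1 h2 hr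
  have hz : ∀ a, ∃ z : ℕ → ℝ, a ∈ B → ∃ r, (0 < z 0 ∧ (∀ i, i + 1 < k + 1 → z i < z (i + 1)) ∧
      ∀ i < k + 1, U a (z i) = 0 ∧ (-1 : ℝ) ^ i * deriv (U a) (z i) < 0) ∧
      z k < r ∧ β ≤ |U a r| := by
    intro a
    by_cases ha : a ∈ B
    · exact ha.imp fun z hz _ => hz
    · exact ⟨0, fun h => absurd h ha⟩
  choose z hz using hz
  refine SolvesOn.not_changesSignExactly (z := z) 𝒰 hm hf hH1.odd (hsol αstar) (hsol0 αstar) h0 hne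
    hequi hdz hS (fun a _ => hsol a) (fun a _ => hsol0 a) hA h𝒰α ?_ hsign
  filter_upwards [h𝒰B, htrap] with a ha htr
  obtain ⟨r, ⟨hz0, hz1, hz2⟩, hr, hβr⟩ := hz a ha
  have hrR : r < R := by
    by_contra! hle
    exact absurd (htr r hle) (not_lt.mpr hβr)
  have hlt := lt_of_forall_lt_succ hz1
  refine ⟨hz1, fun i hi => ⟨⟨?_, ?_⟩, hz2 i hi⟩⟩
  · rcases Nat.eq_zero_or_pos i with h | h
    · rwa [h]
    · exact hz0.trans (hlt i hi 0 h)
  · rcases (Nat.lt_succ_iff.mp hi).eq_or_lt with h | h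
    · rw [h]; exact (hr.trans hrR).le
    · exact ((hlt k (by omega) i h).trans (hr.trans hrR)).le
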